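/- arXiv:1711.02147 — 6 statements merged into one kernel-verified Lean document; each statement's English description precedes it below -/
import Mathlib

section
/- Let n ≥ 2 and let H be a subgroup of SL(n,ℤ). Suppose there is a prime p such that the image of H under the reduction homomorphism φ_p : SL(n,ℤ) → SL(n,ℤ/pℤ) is all of SL(n,ℤ/pℤ). If either n ≥ 3, or n = 2 and p ≥ 3, then H is an infinite group. -/
open Matrix

/-- `SL n R` : the special linear group of `n × n` matrices over `R`. -/
abbrev SL (n : ℕ) (R : Type*) [CommRing R] := Matrix.SpecialLinearGroup (Fin n) R

/-- The reduction-mod-`p` homomorphism `φ_p : SL(n,ℤ) → SL(n,ℤ/pℤ)`. -/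
def redMod (n p : ℕ) : SL n ℤ →* SL n (ZMod p) :=
  Matrix.SpecialLinearGroup.map (Int.castRingHom (ZMod p))

/-- The rational matrix underlying an element of `SL(n,ℤ)`. -/
def matQ {n : ℕ} (g : SL n ℤ) : Matrix (Fin n) (Fin n) ℚ :=
  (g : Matrix (Fin n) (Fin n) ℤ).map ((↑) : ℤ → ℚ)

/-- A subgroup of `SL(n,ℤ)` is absolutely irreducible over `ℚ` if its elements generate the
full matrix algebra over `ℚ`. -/
def AbsIrredQ {n : ℕ} (H : Subgroup (SL n ℤ)) : Prop :=
  Algebra.adjoin ℚ (matQ '' (H : Set (SL n ℤ))) = ⊤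

/-- A subgroup of `SL(n, ℤ/pℤ)` is absolutely irreducible if its elements generate the
full matrix algebra over `ℤ/pℤ`. -/
def AbsIrredMod {n p : ℕ} (G : Subgroup (SL n (ZMod p))) : Prop :=
  Algebra.adjoin (ZMod p)
    ((fun g : SL n (ZMod p) => (g : Matrix (Fin n) (Fin n) (ZMod p))) '' (G : Set _)) = ⊤

/-- Irreducibility of the natural action of a subgroup of `SL(n,R)` on `R^n`. -/
def IrreducibleSub (R : Type*) [CommRing R] {n : ℕ} (G : Subgroup (SL n R)) : Prop :=
  ∀ W : Submodule R (Fin n → R),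
    (∀ g ∈ G, W.map (Matrix.toLin' (g : Matrix (Fin n) (Fin n) R)) ≤ W) → W = ⊥ ∨ W = ⊤

/-- Imprimitivity: a nontrivial direct-sum decomposition whose summands are permuted by `G`. -/
def ImprimitiveSub (R : Type*) [CommRing R] {n : ℕ} (G : Subgroup (SL n R)) : Prop :=
  ∃ m : ℕ, 2 ≤ m ∧ ∃ W : Fin m → Submodule R (Fin n → R),
    (∀ i, W i ≠ ⊥) ∧ DirectSum.IsInternal W ∧
    ∀ g ∈ G, ∀ i, ∃ j, (W i).map (Matrix.toLin' (g : Matrix (Fin n) (Fin n) R)) = W j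

/-- Primitivity: irreducible and not imprimitive. -/
def PrimitiveSub (R : Type*) [CommRing R] {n : ℕ} (G : Subgroup (SL n R)) : Prop :=
  IrreducibleSub R G ∧ ¬ ImprimitiveSub R G

/-- Monomiality: a direct sum of `n` one-dimensional subspaces permuted by `G`. -/
def MonomialSub (R : Type*) [CommRing R] {n : ℕ} (G : Subgroup (SL n R)) : Prop :=
  ∃ L : Fin n → Submodule R (Fin n → R),
    (∀ i, Module.finrank R (L i) = 1) ∧ DirectSum.IsInternal L ∧
    ∀ g ∈ G, ∀ i, ∃ j, (L i).map (Matrix.toLin' (g : Matrix (Fin n) (Fin n) R)) = L j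

/-- Irreducibility of a subgroup of `SL(n,ℤ)` acting on `ℚ^n`. -/
def IrreducibleQ {n : ℕ} (H : Subgroup (SL n ℤ)) : Prop :=
  ∀ W : Submodule ℚ (Fin n → ℚ),
    (∀ g ∈ H, W.map (Matrix.toLin' (matQ g)) ≤ W) → W = ⊥ ∨ W = ⊤

/-- Imprimitivity of a subgroup of `SL(n,ℤ)` acting on `ℚ^n`. -/
def ImprimitiveQ {n : ℕ} (H : Subgroup (SL n ℤ)) : Prop :=
  ∃ m : ℕ, 2 ≤ m ∧ ∃ W : Fin m → Submodule ℚ (Fin n → ℚ),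
    (∀ i, W i ≠ ⊥) ∧ DirectSum.IsInternal W ∧
    ∀ g ∈ H, ∀ i, ∃ j, (W i).map (Matrix.toLin' (matQ g)) = W j

/-- Primitivity of a subgroup of `SL(n,ℤ)` acting on `ℚ^n`. -/
def PrimitiveQ {n : ℕ} (H : Subgroup (SL n ℤ)) : Prop :=
  IrreducibleQ H ∧ ¬ ImprimitiveQ H

/-- A group is solvable-by-finite if it has a solvable subgroup of finite index. -/
def SolvableByFinite (G : Type*) [Group G] : Prop :=
  ∃ K : Subgroup G, IsSolvable K ∧ K.FiniteIndex

/-- A subgroup of `SL(n,ℤ)` is an isometry group if it preserves a nondegenerate bilinear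
form on `ℚ^n`. -/
def IsometryGroupQ {n : ℕ} (H : Subgroup (SL n ℤ)) : Prop :=
  ∃ Φ : Matrix (Fin n) (Fin n) ℚ, IsUnit Φ ∧ ∀ h ∈ H, matQ h * Φ * (matQ h)ᵀ = Φ

section helpers

/-- Transvections. -/
lemma exists_transvection {n : ℕ} {F : Type*} [CommRing F] (f d : Fin n → F)
    (hfd : f ⬝ᵥ d = 0) :
    ∃ g : SL n F, ∀ x, (g : Matrix (Fin n) (Fin n) F) *ᵥ x = x + (f ⬝ᵥ x) • d := by
  refine ⟨⟨1 + vecMulVec d f, ?_⟩, ?_⟩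
  · rw [vecMulVec_eq Unit, det_one_add_replicateCol_mul_replicateRow, hfd, add_zero]
  · intro x
    simp only [add_mulVec, one_mulVec, vecMulVec_mulVec]
    congr 1
    ext i
    simp [mul_comm]

/-- `x` and `y` are related if they lie in the same orbit. -/
lemma orbit_coord {n : ℕ} {F : Type*} [Field F] (x y : Fin n → F) (i : Fin n)
    (hx : x i ≠ 0) (hxy : x i = y i) :
    ∃ g : SL n F, (g : Matrix (Fin n) (Fin n) F) *ᵥ x = y := by
  obtain ⟨g, hg⟩ := exists_transvection (Pi.single i (x i)⁻¹) (y - x) (by simp [hxy])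
  refine ⟨g, ?_⟩
  rw [hg]
  simp [hx]

lemma orbit_coord₂ {n : ℕ} {F : Type*} [Field F] (x y : Fin n → F) (i j : Fin n)
    (hij : i ≠ j) (hx : x i ≠ 0) (hy : y j ≠ 0) :
    ∃ g : SL n F, (g : Matrix (Fin n) (Fin n) F) *ᵥ x = y := by
  obtain ⟨g, hg⟩ := orbit_coord x (Pi.single i (x i) + Pi.single j (y j)) i hx (by simp [hij])
  obtain ⟨g', hg'⟩ := orbit_coord (Pi.single i (x i) + Pi.single j (y j)) y j
    (by simpa [hij.symm]) (by simp [hij.symm])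
  refine ⟨g' * g, ?_⟩
  change (g'.1 * g.1) *ᵥ x = y
  rw [← mulVec_mulVec, hg, hg']

lemma orbit_all {n : ℕ} (hn : 2 ≤ n) {F : Type*} [Field F] (x y : Fin n → F)
    (hx : x ≠ 0) (hy : y ≠ 0) :
    ∃ g : SL n F, (g : Matrix (Fin n) (Fin n) F) *ᵥ x = y := by
  obtain ⟨i, hi⟩ := Function.ne_iff.1 hx
  obtain ⟨j, hj⟩ := Function.ne_iff.1 hy
  by_cases hij : i = j
  · subst hij
    haveI : Nontrivial (Fin n) := Fin.nontrivial_iff_two_le.2 hn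
    obtain ⟨k, hk⟩ := exists_ne i
    obtain ⟨g, hg⟩ := orbit_coord₂ x (Pi.single k 1) i k hk.symm hi (by simp)
    obtain ⟨g', hg'⟩ := orbit_coord₂ (Pi.single k 1) y k i hk (by simp) hj
    refine ⟨g' * g, ?_⟩
    change (g'.1 * g.1) *ᵥ x = y
    rw [← mulVec_mulVec, hg, hg']
  · exact orbit_coord₂ x y i j hij hi hj

/-- Reduction of vectors. -/
def redV (n p : ℕ) (x : Fin n → ℤ) : Fin n → ZMod p := fun i => (x i : ZMod p)

lemma redV_add {n p : ℕ} (x y : Fin n → ℤ) : redV n p (x + y) = redV n p x + redV n p y := by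
  ext i; simp [redV]

lemma redV_sub {n p : ℕ} (x y : Fin n → ℤ) : redV n p (x - y) = redV n p x - redV n p y := by
  ext i; simp [redV]

lemma redV_neg {n p : ℕ} (x : Fin n → ℤ) : redV n p (-x) = - redV n p x := by
  ext i; simp [redV]

lemma redV_zero {n p : ℕ} (x : Fin n → ℤ) (h : redV n p x = 0) :
    ∃ y : Fin n → ℤ, x = (p : ℤ) • y := by
  have : ∀ i, ∃ c : ℤ, x i = p * c := by
    intro i
    have := congrFun h i
    exact (ZMod.intCast_zmod_eq_zero_iff_dvd (x i) p).1 this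
  choose y hy using this
  exact ⟨y, by ext i; simp [hy]⟩

lemma redV_mulVec {n p : ℕ} (g : SL n ℤ) (x : Fin n → ℤ) :
    redV n p ((g : Matrix (Fin n) (Fin n) ℤ) *ᵥ x) =
      ((redMod n p g : SL n (ZMod p)) : Matrix (Fin n) (Fin n) (ZMod p)) *ᵥ redV n p x := by
  ext i
  exact RingHom.map_mulVec (Int.castRingHom (ZMod p)) _ _ i

/-- An invariant positive definite integral form, together with its minimum. -/
structure InvForm (n p : ℕ) where
  H : Subgroup (SL n ℤ)
  surj : H.map (redMod n p) = ⊤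
  B : (Fin n → ℤ) → (Fin n → ℤ) → ℤ
  add_left : ∀ x y z, B (x + y) z = B x z + B y z
  smul_left : ∀ (c : ℤ) x z, B (c • x) z = c * B x z
  symm : ∀ x y, B x y = B y x
  inv : ∀ g ∈ H, ∀ x y, B ((g : Matrix (Fin n) (Fin n) ℤ) *ᵥ x)
    ((g : Matrix (Fin n) (Fin n) ℤ) *ᵥ y) = B x y
  m : ℤ
  m_pos : 0 < m
  m_le : ∀ x, x ≠ 0 → m ≤ B x x
  ex : ∃ x, x ≠ 0 ∧ B x x = m

lemma exists_invForm {n p : ℕ} (hn : 2 ≤ n) (H : Subgroup (SL n ℤ))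
    (hsurj : H.map (redMod n p) = ⊤) [Finite H] : Nonempty (InvForm n p) := by
  haveI := Fintype.ofFinite H
  let B : (Fin n → ℤ) → (Fin n → ℤ) → ℤ := fun x y =>
    ∑ h : H, (((h : SL n ℤ) : Matrix (Fin n) (Fin n) ℤ) *ᵥ x) ⬝ᵥ
      (((h : SL n ℤ) : Matrix (Fin n) (Fin n) ℤ) *ᵥ y)
  have hpos : ∀ x, x ≠ 0 → 0 < B x x := by
    intro x hx
    refine Finset.sum_pos' (fun h _ => ?_) ⟨1, Finset.mem_univ _, ?_⟩
    · exact Finset.sum_nonneg fun i _ => mul_self_nonneg _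
    · have h0 : 0 ≤ x ⬝ᵥ x := Finset.sum_nonneg fun i _ => mul_self_nonneg _
      have h1 : x ⬝ᵥ x ≠ 0 := fun h => hx (dotProduct_self_eq_zero.1 h)
      simpa using lt_of_le_of_ne h0 h1.symm
  have hne : ∃ k : ℕ, ∃ x, x ≠ 0 ∧ B x x = k := by
    let x : Fin n → ℤ := Pi.single ⟨0, by omega⟩ 1
    have hx : x ≠ 0 := by simp [x]
    exact ⟨(B x x).toNat, x, hx, by have := hpos x hx; omega⟩
  classical
  obtain ⟨x, hx, hBx⟩ := Nat.find_spec hne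
  refine ⟨⟨H, hsurj, B, ?_, ?_, ?_, ?_, Nat.find hne, ?_, ?_, ⟨x, hx, hBx⟩⟩⟩
  · intro x y z
    simp only [B, mulVec_add, add_dotProduct, Finset.sum_add_distrib]
  · intro c x z
    simp only [B, mulVec_smul, smul_dotProduct, Finset.mul_sum, smul_eq_mul]
  · intro x y
    simp only [B]
    exact Finset.sum_congr rfl fun h _ => dotProduct_comm _ _
  · intro g hg x y
    simp only [B, mulVec_mulVec, ← SpecialLinearGroup.coe_mul]
    exact Fintype.sum_equiv (Equiv.mulRight (⟨g, hg⟩ : H)) _ _ (fun h => by simp)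
  · rw [← hBx]; exact hpos x hx
  · intro y hy
    have := hpos y hy
    have h2 := Nat.find_min' hne (m := (B y y).toNat) ⟨y, hy, by omega⟩
    omega

namespace InvForm

variable {n p : ℕ} (I : InvForm n p)

lemma add_right (x y z) : I.B x (y + z) = I.B x y + I.B x z := by
  rw [I.symm, I.add_left, I.symm y, I.symm z]

lemma smul_right (c : ℤ) (x z) : I.B x (c • z) = c * I.B x z := by
  rw [I.symm, I.smul_left, I.symm]

lemma neg_left (x z) : I.B (-x) z = - I.B x z := by
  have := I.smul_left (-1) x z
  simpa using this

lemma neg_right (x z) : I.B x (-z) = - I.B x z := by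
  rw [I.symm, I.neg_left, I.symm]

lemma sub_left (x y z) : I.B (x - y) z = I.B x z - I.B y z := by
  rw [sub_eq_add_neg, I.add_left, I.neg_left, sub_eq_add_neg]

lemma sub_right (x y z) : I.B x (y - z) = I.B x y - I.B x z := by
  rw [sub_eq_add_neg, I.add_right, I.neg_right, sub_eq_add_neg]

lemma zero_zero : I.B 0 0 = 0 := by
  have := I.smul_left 0 0 0
  simpa using this

lemma nonneg (x) : 0 ≤ I.B x x := by
  by_cases hx : x = 0
  · subst hx; exact I.zero_zero.ge
  · exact I.m_pos.le.trans (I.m_le x hx)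

/-- Gap property for vectors in `pL`. -/
lemma gap (x) (hx : redV n p x = 0) : x = 0 ∨ (p : ℤ) ^ 2 * I.m ≤ I.B x x := by
  by_cases h0 : x = 0
  · exact Or.inl h0
  · right
    obtain ⟨y, rfl⟩ := redV_zero x hx
    have hy : y ≠ 0 := by rintro rfl; simp at h0
    rw [I.smul_left, I.smul_right, ← mul_assoc, ← sq]
    exact mul_le_mul_of_nonneg_left (I.m_le y hy) (sq_nonneg _)

lemma lift (g : SL n (ZMod p)) : ∃ h ∈ I.H, ∀ x,
    redV n p ((h : Matrix (Fin n) (Fin n) ℤ) *ᵥ x) =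
      (g : Matrix (Fin n) (Fin n) (ZMod p)) *ᵥ redV n p x := by
  have : g ∈ I.H.map (redMod n p) := by rw [I.surj]; trivial
  obtain ⟨h, hh, rfl⟩ := this
  exact ⟨h, hh, fun x => redV_mulVec h x⟩

/-- Minimal vectors represent every nonzero class. -/
lemma exists_min (hn : 2 ≤ n) (hp : p.Prime) (c : Fin n → ZMod p) (hc : c ≠ 0) :
    ∃ x, I.B x x = I.m ∧ redV n p x = c := by
  haveI := Fact.mk hp
  obtain ⟨x, hx, hBx⟩ := I.ex
  have hr : redV n p x ≠ 0 := by
    intro h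
    have h2 : (2 : ℤ) ≤ p := by exact_mod_cast hp.two_le
    rcases I.gap x h with h | h
    · exact hx h
    · have := I.m_pos
      have h4 : (4 : ℤ) ≤ (p : ℤ) ^ 2 := by nlinarith
      have := mul_le_mul_of_nonneg_right h4 I.m_pos.le
      linarith
  obtain ⟨g, hg⟩ := orbit_all hn _ c hr hc
  obtain ⟨h, hh, hl⟩ := I.lift g
  exact ⟨_, (I.inv h hh x x).trans hBx, (hl x).trans hg⟩

lemma rigid_odd (hp : 3 ≤ p) (x y) (hx : I.B x x = I.m) (hy : I.B y y = I.m)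
    (hxy : redV n p x = redV n p y) : x = y := by
  have h1 := I.nonneg (x + y)
  have h3 : (3 : ℤ) ≤ p := by exact_mod_cast hp
  have hm := I.m_pos
  rcases I.gap (x - y) (by rw [redV_sub, hxy, sub_self]) with h | h
  · exact sub_eq_zero.1 h
  · simp only [add_left, add_right, sub_left, sub_right, hx, hy, I.symm y x] at h h1
    have h9 : (9 : ℤ) ≤ (p : ℤ) ^ 2 := by nlinarith
    have := mul_le_mul_of_nonneg_right h9 I.m_pos.le
    linarith

lemma pair_odd (hp : 3 ≤ p) (v w v' w') (hv : I.B v v = I.m) (hw : I.B w w = I.m)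
    (hv' : I.B v' v' = I.m) (hw' : I.B w' w' = I.m) (g : SL n (ZMod p))
    (h1 : (g : Matrix (Fin n) (Fin n) (ZMod p)) *ᵥ redV n p v = redV n p v')
    (h2 : (g : Matrix (Fin n) (Fin n) (ZMod p)) *ᵥ redV n p w = redV n p w') :
    I.B v w = I.B v' w' := by
  obtain ⟨h, hh, hl⟩ := I.lift g
  rw [← I.inv h hh v w,
    I.rigid_odd hp _ v' ((I.inv h hh v v).trans hv) hv' ((hl v).trans h1),
    I.rigid_odd hp _ w' ((I.inv h hh w w).trans hw) hw' ((hl w).trans h2)]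

end InvForm

lemma rigid_two {n : ℕ} (I : InvForm n 2) (x y) (hx : I.B x x = I.m) (hy : I.B y y = I.m)
    (hxy : redV n 2 x = redV n 2 y) : x = y ∨ x = -y := by
  have hm := I.m_pos
  have hz : redV n 2 (x + y) = 0 := by
    rw [redV_add, hxy]; ext i; exact CharTwo.add_self_eq_zero _
  rcases I.gap (x - y) (by rw [redV_sub, hxy, sub_self]) with h | h
  · exact Or.inl (sub_eq_zero.1 h)
  · rcases I.gap (x + y) hz with h' | h'
    · exact Or.inr (eq_neg_of_add_eq_zero_left h')
    · simp only [I.add_left, I.add_right, I.sub_left, I.sub_right, hx, hy, I.symm y x] at h h'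
      push_cast at h h'
      linarith

lemma pair_two {n : ℕ} (I : InvForm n 2) (v w v' w') (hv : I.B v v = I.m) (hw : I.B w w = I.m)
    (hv' : I.B v' v' = I.m) (hw' : I.B w' w' = I.m) (g : SL n (ZMod 2))
    (h1 : (g : Matrix (Fin n) (Fin n) (ZMod 2)) *ᵥ redV n 2 v = redV n 2 v')
    (h2 : (g : Matrix (Fin n) (Fin n) (ZMod 2)) *ᵥ redV n 2 w = redV n 2 w') :
    |I.B v w| = |I.B v' w'| := by
  obtain ⟨h, hh, hl⟩ := I.lift g
  rw [← I.inv h hh v w]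
  rcases rigid_two I _ v' ((I.inv h hh v v).trans hv) hv' ((hl v).trans h1) with e | e <;>
  rcases rigid_two I _ w' ((I.inv h hh w w).trans hw) hw' ((hl w).trans h2) with e' | e' <;>
  rw [e, e'] <;> simp [I.neg_left, I.neg_right]

/-- Transvection moving `x` to `y` and fixing `z`. -/
lemma trv {n : ℕ} {F : Type*} [CommRing F] (f x y z : Fin n → F) (hx : f ⬝ᵥ x = 1)
    (hy : f ⬝ᵥ y = 1) (hz : f ⬝ᵥ z = 0) : ∃ g : SL n F,
    (g : Matrix (Fin n) (Fin n) F) *ᵥ x = y ∧ (g : Matrix (Fin n) (Fin n) F) *ᵥ z = z := by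
  obtain ⟨g, hg⟩ := exists_transvection f (y - x) (by simp [dotProduct_sub, hx, hy])
  exact ⟨g, by simp [hg, hx], by simp [hg, hz]⟩

lemma odd_false {n p : ℕ} (hn : 2 ≤ n) (hp : p.Prime) (hp3 : 3 ≤ p) (I : InvForm n p) :
    False := by
  haveI := Fact.mk hp
  let i : Fin n := ⟨0, by omega⟩
  let j : Fin n := ⟨1, by omega⟩
  have hij : i ≠ j := by simp [i, j]
  have hji := hij.symm
  generalize i = i at hij hji
  generalize j = j at hij hji
  let e : Fin n → ZMod p := Pi.single i 1
  let e' : Fin n → ZMod p := Pi.single j 1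
  obtain ⟨v, hv, rv⟩ := I.exists_min hn hp e (by simp [e])
  obtain ⟨w, hw, rw'⟩ := I.exists_min hn hp e' (by simp [e'])
  obtain ⟨u, hu, ru⟩ := I.exists_min hn hp (e + e') (by
    intro h; have := congrFun h i; simp [e, e', hij] at this)
  have hnv : I.B (-v) (-v) = I.m := by rw [I.neg_left, I.neg_right, neg_neg, hv]
  -- (v, w) to (u, w)
  have a1 : I.B v w = I.B u w := by
    obtain ⟨g, h1, h2⟩ := trv (Pi.single i 1) e (e + e') e'
      (by simp [e]) (by simp [e, e', hij]) (by simp [e', hij])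
    exact I.pair_odd hp3 v w u w hv hw hu hw g (by rw [rv, ru, h1]) (by rw [rw', h2])
  have a2 : I.B w v = I.B u v := by
    obtain ⟨g, h1, h2⟩ := trv (Pi.single j 1) e' (e + e') e
      (by simp [e']) (by simp [e, e', hji]) (by simp [e, hji])
    exact I.pair_odd hp3 w v u v hw hv hu hv g (by rw [rw', ru, h1]) (by rw [rv, h2])
  have a3 : I.B w u = I.B (-v) u := by
    obtain ⟨g, h1, h2⟩ := trv (Pi.single j 1 - Pi.single i 1) e' (-e) (e + e')
      (by simp [e', sub_dotProduct, hij]) (by simp [e, sub_dotProduct, hji])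
      (by simp [e, e', sub_dotProduct, hij, hji])
    exact I.pair_odd hp3 w u (-v) u hw hu hnv hu g (by rw [rw', redV_neg, rv, h1]) (by rw [ru, h2])
  rw [I.neg_left] at a3
  have s1 := I.symm u w
  have s2 := I.symm u v
  have s3 := I.symm w v
  have z1 : I.B v w = 0 := by omega
  have hm := I.m_pos
  rcases I.gap (u - v - w) (by rw [redV_sub, redV_sub, ru, rv, rw']; simp) with h | h
  · have := I.zero_zero
    rw [← h] at this
    simp only [I.sub_left, I.sub_right] at this
    omega
  · have h3 : (3 : ℤ) ≤ p := by exact_mod_cast hp3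
    have : 9 * I.m ≤ (p : ℤ) ^ 2 * I.m :=
      mul_le_mul_of_nonneg_right (by nlinarith) I.m_pos.le
    simp only [I.sub_left, I.sub_right] at h
    linarith

lemma two_false {n : ℕ} (hn : 3 ≤ n) (I : InvForm n 2) : False := by
  haveI := Fact.mk Nat.prime_two
  have hn2 : 2 ≤ n := by omega
  let i : Fin n := ⟨0, by omega⟩
  let j : Fin n := ⟨1, by omega⟩
  let k : Fin n := ⟨2, by omega⟩
  have hij : i ≠ j := by simp [i, j]
  have hik : i ≠ k := by simp [i, k]
  have hjk : j ≠ k := by simp [j, k]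
  generalize i = i at hij hik
  generalize j = j at hij hjk
  generalize k = k at hik hjk
  have hji := hij.symm
  have hki := hik.symm
  have hkj := hjk.symm
  let e₁ : Fin n → ZMod 2 := Pi.single i 1
  let e₂ : Fin n → ZMod 2 := Pi.single j 1
  let e₃ : Fin n → ZMod 2 := Pi.single k 1
  obtain ⟨v, hv, rv⟩ := I.exists_min hn2 Nat.prime_two e₁ (by simp [e₁])
  obtain ⟨w, hw, rw'⟩ := I.exists_min hn2 Nat.prime_two e₂ (by simp [e₂])
  obtain ⟨t, ht, rt⟩ := I.exists_min hn2 Nat.prime_two e₃ (by simp [e₃])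
  obtain ⟨u, hu, ru⟩ := I.exists_min hn2 Nat.prime_two (e₁ + e₂) (by
    intro h; have := congrFun h i; simp [e₁, e₂, hij] at this)
  obtain ⟨r, hr, rr⟩ := I.exists_min hn2 Nat.prime_two (e₂ + e₃) (by
    intro h; have := congrFun h j; simp [e₂, e₃, hjk] at this)
  have a1 : |I.B v w| = |I.B u w| := by
    obtain ⟨g, h1, h2⟩ := trv (Pi.single i 1) e₁ (e₁ + e₂) e₂
      (by simp [e₁]) (by simp [e₁, e₂, hij]) (by simp [e₂, hij])
    exact pair_two I v w u w hv hw hu hw g (by rw [rv, ru, h1]) (by rw [rw', h2])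
  have a2 : |I.B w v| = |I.B u v| := by
    obtain ⟨g, h1, h2⟩ := trv (Pi.single j 1) e₂ (e₁ + e₂) e₁
      (by simp [e₂]) (by simp [e₁, e₂, hji]) (by simp [e₁, hji])
    exact pair_two I w v u v hw hv hu hv g (by rw [rw', ru, h1]) (by rw [rv, h2])
  have a3 : |I.B w v| = |I.B r v| := by
    obtain ⟨g, h1, h2⟩ := trv (Pi.single j 1) e₂ (e₂ + e₃) e₁
      (by simp [e₂]) (by simp [e₃, e₂, hjk]) (by simp [e₁, hji])
    exact pair_two I w v r v hw hv hr hv g (by rw [rw', rr, h1]) (by rw [rv, h2])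
  have a4 : |I.B r v| = |I.B t v| := by
    obtain ⟨g, h1, h2⟩ := trv (Pi.single k 1) (e₂ + e₃) e₃ e₁
      (by simp [e₃, e₂, hkj]) (by simp [e₃]) (by simp [e₁, hki])
    exact pair_two I r v t v hr hv ht hv g (by rw [rr, rt, h1]) (by rw [rv, h2])
  have a5 : |I.B v t| = |I.B u t| := by
    obtain ⟨g, h1, h2⟩ := trv (Pi.single i 1) e₁ (e₁ + e₂) e₃
      (by simp [e₁]) (by simp [e₁, e₂, hij]) (by simp [e₃, hik])
    exact pair_two I v t u t hv ht hu ht g (by rw [rv, ru, h1]) (by rw [rt, h2])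
  have a6 : |I.B u t| = |I.B w t| := by
    obtain ⟨g, h1, h2⟩ := trv (Pi.single j 1) (e₁ + e₂) e₂ e₃
      (by simp [e₁, e₂, hji]) (by simp [e₂]) (by simp [e₃, hjk])
    exact pair_two I u t w t hu ht hw ht g (by rw [ru, rw', h1]) (by rw [rt, h2])
  have s1 := I.symm u w
  have s2 := I.symm u v
  have s3 := I.symm w v
  have s4 := I.symm v t
  have hm := I.m_pos
  have hz := I.zero_zero
  have key : ∀ x, redV n 2 x = 0 → I.B x x = 0 ∨ 4 * I.m ≤ I.B x x := by
    intro x hx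
    rcases I.gap x hx with h | h
    · left; rw [h, hz]
    · right; push_cast at h; linarith
  have dbl : ∀ x : Fin n → ZMod 2, x + x = 0 := fun x => by
    ext l; exact CharTwo.add_self_eq_zero _
  have neg2 : ∀ x : Fin n → ZMod 2, -x = x := fun x => neg_eq_of_add_eq_zero_left (dbl x)
  have k1 := key (u - v - w) (by rw [redV_sub, redV_sub, ru, rv, rw']; simp)
  have k2 := key (u + v + w) (by
    rw [redV_add, redV_add, ru, rv, rw', add_assoc]; exact dbl _)
  have k3 := key (u - v + w) (by
    rw [redV_add, redV_sub, ru, rv, rw', sub_eq_add_neg, neg2, add_assoc]; exact dbl _)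
  have k4 := key (u + v - w) (by
    rw [redV_sub, redV_add, ru, rv, rw', sub_eq_add_neg, neg2, add_assoc]; exact dbl _)
  have p1 := I.nonneg (v + w)
  have p2 := I.nonneg (v - w)
  simp only [I.add_left, I.add_right, I.sub_left, I.sub_right] at k1 k2 k3 k4 p1 p2
  have hc : 2 * |I.B v w| = I.m := by
    rw [s3] at a2
    rcases abs_cases (I.B v w) with ⟨q1, _⟩ | ⟨q1, _⟩ <;>
    rcases abs_cases (I.B u w) with ⟨q2, _⟩ | ⟨q2, _⟩ <;>
    rcases abs_cases (I.B u v) with ⟨q3, _⟩ | ⟨q3, _⟩ <;> omega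
  have hfin : ∀ s, redV n 2 s = e₁ + e₂ → I.B s s = I.m → |I.B s t| = |I.B u t| := by
    intro s hs hss
    rcases rigid_two I s u hss hu (hs.trans ru.symm) with h | h
    · rw [h]
    · rw [h, I.neg_left, abs_neg]
  rw [s3] at a3
  rw [← s4] at a4
  rcases abs_cases (I.B v w) with ⟨q1, _⟩ | ⟨q1, _⟩
  · have := hfin (v - w) (by rw [redV_sub, rv, rw', sub_eq_add_neg, neg2])
      (by simp only [I.sub_left, I.sub_right]; omega)
    rw [I.sub_left] at this
    rcases abs_cases (I.B v t) with ⟨q2, _⟩ | ⟨q2, _⟩ <;>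
    rcases abs_cases (I.B w t) with ⟨q3, _⟩ | ⟨q3, _⟩ <;>
    rcases abs_cases (I.B v t - I.B w t) with ⟨q4, _⟩ | ⟨q4, _⟩ <;> omega
  · have := hfin (v + w) (by rw [redV_add, rv, rw'])
      (by simp only [I.add_left, I.add_right]; omega)
    rw [I.add_left] at this
    rcases abs_cases (I.B v t) with ⟨q2, _⟩ | ⟨q2, _⟩ <;>
    rcases abs_cases (I.B w t) with ⟨q3, _⟩ | ⟨q3, _⟩ <;>
    rcases abs_cases (I.B v t + I.B w t) with ⟨q4, _⟩ | ⟨q4, _⟩ <;> omega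

end helpers

/-- If `φ_p(H) = SL(n, ℤ/pℤ)` for a prime `p`, with `n ≥ 3`, or `n = 2` and
`p ≥ 3`, then `H` is infinite. -/
theorem congruence_surjective_implies_infinite (n p : ℕ) (hn : 2 ≤ n) (hp : p.Prime)
    (H : Subgroup (SL n ℤ)) (hsurj : H.map (redMod n p) = ⊤)
    (hcase : 3 ≤ n ∨ (n = 2 ∧ 3 ≤ p)) :
    Infinite H := by
  by_contra hinf
  haveI : Finite H := not_infinite_iff_finite.1 hinf
  obtain ⟨I⟩ := exists_invForm hn H hsurj
  by_cases hp3 : 3 ≤ p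
  · exact odd_false hn hp hp3 I
  · have h2 : p = 2 := by have := hp.two_le; omega
    subst h2
    exact two_false (by omega) I
end

section
/- Let H be a subgroup of SL(n,ℤ) that is absolutely irreducible over ℚ. Then for all but finitely many primes p, the image φ_p(H) is an absolutely irreducible subgroup of SL(n,ℤ/pℤ). -/
open Matrix

lemma clear_denominators {n : ℕ} (H : Subgroup (SL n ℤ)) (M : Matrix (Fin n) (Fin n) ℚ)
    (hM : M ∈ Algebra.adjoin ℚ (matQ '' (H : Set (SL n ℤ)))) :
    ∃ d : ℤ, d ≠ 0 ∧ ∃ N ∈ Algebra.adjoin ℤ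
      ((fun g : SL n ℤ => (g : Matrix (Fin n) (Fin n) ℤ)) '' (H : Set (SL n ℤ))),
      (Int.castRingHom ℚ).mapMatrix N = (d : ℚ) • M := by
  induction hM using Algebra.adjoin_induction with
  | mem x hx =>
    obtain ⟨g, hg, rfl⟩ := hx
    refine ⟨1, one_ne_zero, g, Algebra.subset_adjoin ⟨g, hg, rfl⟩, ?_⟩
    ext i j
    simp [matQ]
  | algebraMap r =>
    refine ⟨r.den, by exact_mod_cast r.den_ne_zero, algebraMap ℤ _ r.num,
      Subalgebra.algebraMap_mem _ _, ?_⟩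
    have h : ((r.den : ℤ) : ℚ) * r = (r.num : ℚ) := by
      exact_mod_cast Rat.den_mul_eq_num r
    rw [eq_intCast, map_intCast, Algebra.smul_def, ← map_mul, h, map_intCast]
  | add x y _ _ hx hy =>
    obtain ⟨d, hd, N, hN, e⟩ := hx
    obtain ⟨d', hd', N', hN', e'⟩ := hy
    refine ⟨d * d', mul_ne_zero hd hd', d' • N + d • N',
      add_mem (Subalgebra.smul_mem _ hN _) (Subalgebra.smul_mem _ hN' _), ?_⟩
    rw [map_add, map_zsmul, map_zsmul, e, e', ← Int.cast_smul_eq_zsmul ℚ,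
      ← Int.cast_smul_eq_zsmul ℚ, smul_smul, smul_smul, smul_add]
    push_cast
    rw [mul_comm]
  | mul x y _ _ hx hy =>
    obtain ⟨d, hd, N, hN, e⟩ := hx
    obtain ⟨d', hd', N', hN', e'⟩ := hy
    refine ⟨d * d', mul_ne_zero hd hd', N * N', mul_mem hN hN', ?_⟩
    rw [map_mul, e, e', smul_mul_smul_comm]
    push_cast
    rfl

lemma reduce_mem {n p : ℕ} (H : Subgroup (SL n ℤ)) (N : Matrix (Fin n) (Fin n) ℤ)
    (hN : N ∈ Algebra.adjoin ℤ
      ((fun g : SL n ℤ => (g : Matrix (Fin n) (Fin n) ℤ)) '' (H : Set (SL n ℤ)))) :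
    (Int.castRingHom (ZMod p)).mapMatrix N ∈ Algebra.adjoin (ZMod p)
      ((fun g : SL n (ZMod p) => (g : Matrix (Fin n) (Fin n) (ZMod p))) ''
        (H.map (redMod n p) : Set _)) := by
  induction hN using Algebra.adjoin_induction with
  | mem x hx =>
    obtain ⟨g, hg, rfl⟩ := hx
    exact Algebra.subset_adjoin ⟨redMod n p g, ⟨g, hg, rfl⟩, rfl⟩
  | algebraMap r =>
    rw [eq_intCast, map_intCast]
    exact intCast_mem _ r
  | add x y _ _ hx hy => rw [map_add]; exact add_mem hx hy
  | mul x y _ _ hx hy => rw [map_mul]; exact mul_mem hx hy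

/-- If `H ≤ SL(n,ℤ)` is absolutely irreducible over `ℚ`, then `φ_p(H)` is
absolutely irreducible for all but finitely many primes `p`. -/
theorem absolutely_irreducible_mod_p_cofinitely (n : ℕ) (hn : 2 ≤ n)
    (H : Subgroup (SL n ℤ)) (hH : AbsIrredQ H) :
    {p : ℕ | p.Prime ∧ ¬ AbsIrredMod (H.map (redMod n p))}.Finite := by
  have key := fun i j : Fin n => clear_denominators H (Matrix.single i j 1)
    (by rw [show Algebra.adjoin ℚ (matQ '' (H : Set (SL n ℤ))) = ⊤ from hH]; trivial)
  choose d hd N hN e using key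
  have hN' : ∀ i j, N i j = Matrix.single i j (d i j) := by
    intro i j
    ext a b
    have h := congrFun (congrFun (e i j) a) b
    simp only [RingHom.mapMatrix_apply, Matrix.map_apply, Matrix.smul_apply,
      Matrix.single_apply, Int.coe_castRingHom, smul_eq_mul] at h ⊢
    split_ifs at h ⊢ <;> simpa using h
  have hD : (∏ i, ∏ j, d i j) ≠ 0 :=
    Finset.prod_ne_zero_iff.2 fun i _ => Finset.prod_ne_zero_iff.2 fun j _ => hd i j
  refine ((Finset.finite_toSet (Nat.divisors (∏ i, ∏ j, d i j).natAbs))).subset ?_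
  rintro p ⟨hp, hirr⟩
  rw [Finset.mem_coe, Nat.mem_divisors]
  refine ⟨?_, Int.natAbs_ne_zero.2 hD⟩
  by_contra hdvd
  apply hirr
  have : Fact p.Prime := ⟨hp⟩
  have hu : ∀ i j, (d i j : ZMod p) ≠ 0 := by
    intro i j h0
    apply hdvd
    rw [ZMod.intCast_zmod_eq_zero_iff_dvd] at h0
    refine Int.natCast_dvd.1 (h0.trans ?_)
    exact (Finset.dvd_prod_of_mem (fun j => d i j) (Finset.mem_univ j)).trans
      (Finset.dvd_prod_of_mem (fun i => ∏ j, d i j) (Finset.mem_univ i))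
  refine (Algebra.eq_top_iff).2 fun M => ?_
  rw [Matrix.matrix_eq_sum_single M]
  refine sum_mem fun i _ => sum_mem fun j _ => ?_
  have h := Subalgebra.smul_mem _ (reduce_mem (p := p) H _ (hN i j)) (M i j * (d i j : ZMod p)⁻¹)
  rw [hN'] at h
  convert h using 1
  ext a b
  simp only [RingHom.mapMatrix_apply, Matrix.map_apply, Matrix.smul_apply,
      Matrix.single_apply, Int.coe_castRingHom, smul_eq_mul]
  split_ifs
  · rw [mul_assoc, inv_mul_cancel₀ (hu i j), mul_one]
  · simp
end

section
/- Let H be a finitely generated subgroup of SL(n,ℤ) that is not solvable-by-finite. Then for all but finitely many primes p, the image φ_p(H) is not a monomial subgroup of SL(n,ℤ/pℤ). -/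
open Matrix

lemma monomial_hom {n p : ℕ} (hp : p.Prime) (H : Subgroup (SL n ℤ))
    (hM : MonomialSub (ZMod p) (H.map (redMod n p))) :
    ∃ f : H →* Equiv.Perm (Fin n), ∀ a b : H, f a = 1 → f b = 1 →
      redMod n p (a * b : SL n ℤ) = redMod n p (b * a : SL n ℤ) := by
  haveI : Fact p.Prime := ⟨hp⟩
  obtain ⟨L, h1, h2, h3⟩ := hM
  have hne : ∀ i, L i ≠ ⊥ := by
    intro i h
    have := h1 i
    rw [h] at this
    simp at this
  have hinj : Function.Injective L := h2.submodule_iSupIndep.injective hne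
  let T : H → ((Fin n → ZMod p) →ₗ[ZMod p] (Fin n → ZMod p)) := fun g =>
    Matrix.toLin' ((redMod n p (g : SL n ℤ) : SL n (ZMod p)) : Matrix (Fin n) (Fin n) (ZMod p))
  have hT1 : T 1 = LinearMap.id := by simp [T]
  have hTm : ∀ a b, T (a * b) = (T a).comp (T b) := by
    intro a b
    simp only [T, Subgroup.coe_mul, map_mul, Matrix.SpecialLinearGroup.coe_mul, Matrix.toLin'_mul]
  have h3' : ∀ g : H, ∀ i, ∃ j, (L i).map (T g) = L j := fun g i =>
    h3 _ (Subgroup.mem_map_of_mem _ g.2) i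
  choose σ hσ using h3'
  let e : H →* Function.End (Fin n) :=
    { toFun := fun g => σ g
      map_one' := by
        funext i
        apply hinj
        rw [← hσ, hT1, Submodule.map_id]
        rfl
      map_mul' := by
        intro a b
        funext i
        apply hinj
        rw [← hσ, hTm, Submodule.map_comp, hσ, hσ]
        rfl }
  refine ⟨e.toHomPerm, ?_⟩
  have key : ∀ a : H, e.toHomPerm a = 1 → ∀ i, (L i).map (T a) = L i := by
    intro a ha i
    have : σ a i = i := by
      have := congrArg (fun s : Equiv.Perm (Fin n) => s i) ha
      exact this
    rw [hσ, this]
  intro a b ha hb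
  have hcomm : (T a).comp (T b) = (T b).comp (T a) := by
    have htop : (⊤ : Submodule (ZMod p) (Fin n → ZMod p)) ≤
        LinearMap.eqLocus ((T a).comp (T b)) ((T b).comp (T a)) := by
      rw [← h2.submodule_iSup_eq_top]
      refine iSup_le fun i v hv => ?_
      obtain ⟨w, hw0, hw⟩ := finrank_eq_one_iff'.mp (h1 i)
      have hsc : ∀ c : H, e.toHomPerm c = 1 → ∃ t : ZMod p, ∀ u ∈ L i, T c u = t • u := by
        intro c hc
        have hm : T c w ∈ L i := by
          have := Submodule.mem_map_of_mem (f := T c) w.2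
          rwa [key c hc i] at this
        obtain ⟨t, ht⟩ := hw ⟨_, hm⟩
        have ht' : t • (w : Fin n → ZMod p) = T c w := congrArg Subtype.val ht
        refine ⟨t, fun u hu => ?_⟩
        obtain ⟨s, hs⟩ := hw ⟨u, hu⟩
        have hs' : s • (w : Fin n → ZMod p) = u := congrArg Subtype.val hs
        rw [← hs', map_smul, ← ht', smul_comm]
      obtain ⟨s, hs⟩ := hsc a ha
      obtain ⟨t, ht⟩ := hsc b hb
      simp only [LinearMap.mem_eqLocus, LinearMap.comp_apply]
      rw [ht v hv, hs v hv, map_smul, map_smul, ht v hv, hs v hv, smul_comm]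
    ext1 i
    ext1
    exact htop trivial
  rw [← hTm, ← hTm] at hcomm
  have := Matrix.toLin'.injective hcomm
  exact Subtype.ext this

/-- If `H ≤ SL(n,ℤ)` is finitely generated and not solvable-by-finite, then
`φ_p(H)` is non-monomial for all but finitely many primes `p`. -/
theorem not_monomial_mod_p_cofinitely (n : ℕ) (hn : 2 ≤ n)
    (H : Subgroup (SL n ℤ)) (hFG : H.FG) (hH : ¬ SolvableByFinite H) :
    {p : ℕ | p.Prime ∧ MonomialSub (ZMod p) (H.map (redMod n p))}.Finite := by
  by_contra hinf
  apply hH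
  haveI : Finite (H →* Equiv.Perm (Fin n)) := by
    haveI : Group.FG H := (Group.fg_iff_subgroup_fg H).mpr hFG
    obtain ⟨S, hS⟩ := Group.fg_def.mp this
    refine Finite.of_injective
      (fun (f : H →* Equiv.Perm (Fin n)) => fun s : S => f s) ?_
    intro f g hfg
    refine MonoidHom.eq_of_eqOn_dense hS ?_
    intro x hx
    exact congrFun hfg ⟨x, hx⟩
  refine ⟨⨅ f : H →* Equiv.Perm (Fin n), f.ker, ?_, ?_⟩
  · refine isSolvable_of_comm ?_
    rintro ⟨a, ha⟩ ⟨b, hb⟩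
    rw [Subgroup.mem_iInf] at ha hb
    apply Subtype.ext
    apply Subtype.ext
    change (a * b : SL n ℤ) = (b * a : SL n ℤ)
    apply Subtype.ext
    ext i j
    by_contra hne
    apply hinf
    have hne' := sub_ne_zero.mpr hne
    refine (Set.finite_le_nat (Int.natAbs
      (((a * b : SL n ℤ) : Matrix (Fin n) (Fin n) ℤ) i j -
        ((b * a : SL n ℤ) : Matrix (Fin n) (Fin n) ℤ) i j))).subset ?_
    rintro p ⟨hp, hM⟩
    obtain ⟨f, hf⟩ := monomial_hom hp H hM
    have h := hf a b (ha f) (hb f)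
    have h' : (((a * b : SL n ℤ) : Matrix (Fin n) (Fin n) ℤ) i j : ZMod p) =
        (((b * a : SL n ℤ) : Matrix (Fin n) (Fin n) ℤ) i j : ZMod p) :=
      congrFun (congrFun (congrArg Subtype.val h) i) j
    have hd : (p : ℤ) ∣ _ := (ZMod.intCast_eq_intCast_iff_dvd_sub _ _ _).mp h'.symm
    exact Nat.le_of_dvd (Int.natAbs_pos.mpr hne') (Int.natCast_dvd.mp hd)
  · exact Subgroup.finiteIndex_iInf fun f => inferInstance
end

section
/- Let n be a prime. If H is an infinite, solvable-by-finite, primitive (in particular irreducible) subgroup of SL(n,ℤ), then H is solvable. -/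
open Matrix

namespace PrimSolv

variable {V G R : Type*} [AddCommGroup V] [Module ℚ V] [Group G]

section ringpart
variable [CommRing R] [Algebra ℚ R] [Module R V] [IsScalarTower ℚ R V]

/-- The image of the part killed by `I` under `ρ g` is the part killed by `σ g I`. -/
theorem map_torsion (ρ : G →* Module.End ℚ V) (σ : G →* (R ≃ₐ[ℚ] R))
    (hσ : ∀ g r v, ρ g (r • v) = σ g r • ρ g v) (g : G) (I : Ideal R) :
    ((Submodule.torsionBySet R V (I : Set R)).restrictScalars ℚ).map (ρ g) =
      (Submodule.torsionBySet R V ((I.comap (σ g).symm : Ideal R) : Set R)).restrictScalars ℚ := by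
  have hinv : ∀ v, ρ g (ρ g⁻¹ v) = v := fun v => by
    rw [← Module.End.mul_apply, ← map_mul]; simp
  have hinj : Function.Injective (ρ g) := fun x y h => by
    have h2 := congrArg (ρ g⁻¹) h
    simpa only [← Module.End.mul_apply, ← map_mul, inv_mul_cancel, map_one, Module.End.one_apply]
      using h2
  ext v
  simp only [Submodule.mem_map, Submodule.restrictScalars_mem, Submodule.mem_torsionBySet_iff]
  constructor
  · rintro ⟨w, hw, rfl⟩ ⟨r, hr⟩
    have hr' : (σ g).symm r ∈ I := hr
    have := hσ g ((σ g).symm r) w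
    rw [hw ⟨_, hr'⟩] at this
    simpa using this.symm
  · intro h
    refine ⟨ρ g⁻¹ v, ?_, hinv v⟩
    rintro ⟨r, hr⟩
    apply hinj
    have := h ⟨σ g r, by simpa using hr⟩
    simp only at this ⊢
    rw [hσ, hinv, this, map_zero]

theorem isField_of_primitive [FiniteDimensional ℚ V] [Nontrivial V] [FaithfulSMul R V]
    [FiniteDimensional ℚ R]
    (ρ : G →* Module.End ℚ V) (σ : G →* (R ≃ₐ[ℚ] R))
    (hσ : ∀ g r v, ρ g (r • v) = σ g r • ρ g v)
    (hirr : ∀ W : Submodule ℚ V, (∀ g, W.map (ρ g) ≤ W) → W = ⊥ ∨ W = ⊤)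
    (hprim : ¬ ∃ m : ℕ, 2 ≤ m ∧ ∃ W : Fin m → Submodule ℚ V,
      (∀ i, W i ≠ ⊥) ∧ DirectSum.IsInternal W ∧ ∀ g, ∀ i, ∃ j, (W i).map (ρ g) = W j) :
    IsField R := by
  classical
  have : Nontrivial R := by
    by_contra h
    rw [not_nontrivial_iff_subsingleton] at h
    obtain ⟨v, hv⟩ := exists_ne (0 : V)
    apply hv
    rw [← one_smul R v, Subsingleton.elim (1 : R) 0, zero_smul]
  have : IsArtinianRing R := IsArtinianRing.of_finite ℚ R
  have : Module.Finite R V := Module.Finite.of_restrictScalars_finite ℚ R V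
  have := Fintype.ofFinite (MaximalSpectrum R)
  -- the Jacobson radical kills V
  have hJ : Module.IsTorsionBySet R V
      ((⨅ i ∈ (Finset.univ : Finset (MaximalSpectrum R)), i.asIdeal : Ideal R) : Set R) := by
    set J : Ideal R := ⨅ i ∈ (Finset.univ : Finset (MaximalSpectrum R)), i.asIdeal with hJdef
    have hJmem : ∀ r, r ∈ J ↔ ∀ I : Ideal R, I.IsMaximal → r ∈ I := by
      intro r
      simp only [hJdef, Finset.mem_univ, iInf_pos, Submodule.mem_iInf]
      exact ⟨fun h I hI => h ⟨I, hI⟩, fun h I => h _ I.isMaximal⟩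
    have hJσ : ∀ g r, r ∈ J → σ g r ∈ J := by
      intro g r hr
      rw [hJmem] at hr ⊢
      intro I hI
      have : (I.comap (σ g)).IsMaximal := Ideal.comap_isMaximal_of_equiv (σ g)
      exact hr _ this
    have hJle : J ≤ (⊥ : Ideal R).jacobson := by
      intro r hr
      rw [Ideal.jacobson, Submodule.mem_sInf]
      exact fun I hI => (hJmem r).1 hr I hI.2
    rcases hirr ((J • (⊤ : Submodule R V)).restrictScalars ℚ) (by
        intro g
        rw [Submodule.map_le_iff_le_comap]
        intro v hv
        rw [Submodule.restrictScalars_mem] at hv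
        rw [Submodule.mem_comap, Submodule.restrictScalars_mem]
        refine Submodule.smul_induction_on hv ?_ ?_
        · intro r hr w _
          rw [hσ]
          exact Submodule.smul_mem_smul (hJσ g r hr) trivial
        · intro x y hx hy
          rw [map_add]; exact add_mem hx hy) with h | h
    · rintro v ⟨r, hr⟩
      have : r • v ∈ J • (⊤ : Submodule R V) := Submodule.smul_mem_smul hr trivial
      rw [← Submodule.restrictScalars_mem ℚ, h] at this
      simpa using this
    · exfalso
      have h2 : (⊤ : Submodule R V) ≤ J • ⊤ := by
        intro v _
        rw [← Submodule.restrictScalars_mem ℚ, h]; trivial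
      have h3 := Submodule.eq_bot_of_le_smul_of_le_jacobson_bot J ⊤ Module.Finite.fg_top h2 hJle
      exact top_ne_bot h3
  have hint := Submodule.torsionBySet_isInternal (R := R) (M := V)
    (S := (Finset.univ : Finset (MaximalSpectrum R))) (p := MaximalSpectrum.asIdeal)
    (by
      intro i _ j _ hij
      exact Ideal.IsMaximal.coprime_of_ne i.isMaximal j.isMaximal
        (fun h => hij (MaximalSpectrum.ext h))) hJ
  let W : ↥(Finset.univ : Finset (MaximalSpectrum R)) → Submodule ℚ V := fun i =>
    (Submodule.torsionBySet R V (i.1.asIdeal : Set R)).restrictScalars ℚ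
  have hW : DirectSum.IsInternal W := hint
  rw [← DirectSum.isInternal_ne_bot_iff,
    DirectSum.isInternal_submodule_iff_iSupIndep_and_iSup_eq_top] at hW
  obtain ⟨hind, hsup⟩ := hW
  let S := {i // W i ≠ ⊥}
  let e : Fin (Fintype.card S) ≃ S := (Fintype.equivFin S).symm
  have hcard : Fintype.card S ≤ 1 := by
    by_contra hc
    refine hprim ⟨Fintype.card S, by omega, fun i => W (e i), fun i => (e i).2, ?_, ?_⟩
    · rw [DirectSum.isInternal_submodule_iff_iSupIndep_and_iSup_eq_top]
      refine ⟨hind.comp e.injective, ?_⟩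
      rw [← hsup]
      exact e.iSup_comp (g := fun i : S => W i)
    · intro g i
      let I : Ideal R := (e i).1.1.asIdeal
      have hI : I.IsMaximal := (e i).1.1.isMaximal
      have hI' : (I.comap (σ g).symm).IsMaximal := Ideal.comap_isMaximal_of_equiv (σ g).symm
      have hm : (W (e i)).map (ρ g) = W ⟨⟨I.comap (σ g).symm, hI'⟩, Finset.mem_univ _⟩ :=
        map_torsion ρ σ hσ g I
      have hne : W ⟨⟨I.comap (σ g).symm, hI'⟩, Finset.mem_univ _⟩ ≠ ⊥ := by
        rw [← hm]
        intro h0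
        apply (e i).2
        rw [Submodule.eq_bot_iff] at h0 ⊢
        intro x hx
        have := congrArg (ρ g⁻¹) (h0 _ (Submodule.mem_map_of_mem hx))
        simpa only [← Module.End.mul_apply, ← map_mul, inv_mul_cancel, map_one,
          Module.End.one_apply, map_zero] using this
      refine ⟨e.symm ⟨_, hne⟩, ?_⟩
      rw [hm]
      simp only [Equiv.apply_symm_apply]
  have : Subsingleton S := Fintype.card_le_one_iff_subsingleton.1 hcard
  rcases isEmpty_or_nonempty S with hS | ⟨⟨s⟩⟩
  · have : (⨆ i : S, W i) = ⊥ := iSup_of_empty _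
    exact absurd (hsup.symm.trans this) top_ne_bot
  · have htop : W s = ⊤ := by
      rw [← hsup]
      refine le_antisymm (le_iSup (fun i : S => W i) s) (iSup_le fun i => ?_)
      rw [Subsingleton.elim i s]
    have hbot : s.1.1.asIdeal = ⊥ := by
      rw [eq_bot_iff]
      intro r hr
      rw [Ideal.mem_bot]
      apply FaithfulSMul.eq_of_smul_eq_smul (α := V)
      intro v
      have hv : v ∈ W s := by rw [htop]; trivial
      have := (Submodule.mem_torsionBySet_iff _ _).1 hv ⟨r, hr⟩
      rw [zero_smul]; exact this
    have hmax := s.1.1.isMaximal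
    rw [hbot] at hmax
    by_contra hnf
    obtain ⟨I, h1, h2⟩ := Ring.not_isField_iff_exists_ideal_bot_lt_and_lt_top.1 hnf
    exact h2.ne (hmax.1.2 I h1)

end ringpart

theorem solvable_of_field {E : Type*} [Field E] [Algebra ℚ E] [Module E V] [IsScalarTower ℚ E V]
    [FiniteDimensional ℚ V] [FiniteDimensional ℚ E]
    (ρ : G →* Module.End ℚ V) (hρ : Function.Injective ρ) (σ : G →* (E ≃ₐ[ℚ] E))
    (hσ : ∀ g r v, ρ g (r • v) = σ g r • ρ g v) (hV : (Module.finrank ℚ V).Prime)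
    (hE : Module.finrank ℚ E ≠ 1) : Group.IsSolvable G := by
  have hmul := Module.finrank_mul_finrank ℚ E V
  have hdim : Module.finrank ℚ E = Module.finrank ℚ V :=
    ((Nat.dvd_prime hV).1 ⟨_, hmul.symm⟩).resolve_left hE
  have hpr : (Module.finrank ℚ E).Prime := hdim ▸ hV
  have hnt : Nontrivial V := Module.nontrivial_of_finrank_pos hV.pos
  obtain ⟨v, hv⟩ := exists_ne (0 : V)
  have hsurj : ∀ w : V, ∃ r : E, r • v = w := by
    have hinj : Function.Injective ((LinearMap.toSpanSingleton E V v).restrictScalars ℚ) :=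
      smul_left_injective E hv
    exact (LinearMap.injective_iff_surjective_of_finrank_eq_finrank hdim).1 hinj
  have : Group.IsSolvable (E ≃ₐ[ℚ] E) := by
    have h1 := IntermediateField.finrank_fixedField_eq_card (F := ℚ) (E := E) ⊤
    rw [Nat.card_congr Subgroup.topEquiv.toEquiv] at h1
    have h2 := Module.finrank_mul_finrank ℚ
      (IntermediateField.fixedField (⊤ : Subgroup (E ≃ₐ[ℚ] E))) E
    rw [h1] at h2
    rcases (Nat.dvd_prime hpr).1 ⟨_, ((mul_comm _ _).trans h2).symm⟩ with h | h
    · have := (Nat.card_eq_one_iff_unique.1 h).1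
      infer_instance
    · have := Fact.mk hpr
      have := isCyclic_of_prime_card h
      letI := IsCyclic.commGroup (α := E ≃ₐ[ℚ] E)
      exact Group.isSolvable_of_comm (fun a b => mul_comm a b)
  have hk : Group.IsSolvable σ.ker := by
    apply Group.isSolvable_of_comm
    rintro ⟨a, ha⟩ ⟨b, hb⟩
    rw [Subtype.ext_iff]
    apply hρ
    rw [MonoidHom.mem_ker] at ha hb
    ext w
    obtain ⟨f, rfl⟩ := hsurj w
    obtain ⟨x, hx⟩ := hsurj (ρ a v)
    obtain ⟨y, hy⟩ := hsurj (ρ b v)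
    simp only [Subgroup.coe_mul, map_mul, Module.End.mul_apply, hσ, ha, hb, AlgEquiv.one_apply,
      ← hx, ← hy]
    rw [smul_comm y x]
  exact Group.isSolvable_of_ker_le_range σ.ker.subtype σ (by simp)

theorem solvable_of_normal_abelian [FiniteDimensional ℚ V]
    (ρ : G →* Module.End ℚ V) (hρ : Function.Injective ρ) (hV : (Module.finrank ℚ V).Prime)
    (hirr : ∀ W : Submodule ℚ V, (∀ g, W.map (ρ g) ≤ W) → W = ⊥ ∨ W = ⊤)
    (hprim : ¬ ∃ m : ℕ, 2 ≤ m ∧ ∃ W : Fin m → Submodule ℚ V,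
      (∀ i, W i ≠ ⊥) ∧ DirectSum.IsInternal W ∧ ∀ g, ∀ i, ∃ j, (W i).map (ρ g) = W j)
    (A : Subgroup G) [hA : A.Normal] (hcomm : ∀ a ∈ A, ∀ b ∈ A, a * b = b * a)
    (hns : ∃ a ∈ A, ∀ c : ℚ, ρ a ≠ c • 1) : Group.IsSolvable G := by
  have hnt : Nontrivial V := Module.nontrivial_of_finrank_pos hV.pos
  have hc : ∀ a ∈ ρ '' (A : Set G), ∀ b ∈ ρ '' (A : Set G), a * b = b * a := by
    rintro _ ⟨a, ha, rfl⟩ _ ⟨b, hb, rfl⟩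
    rw [← map_mul, hcomm a ha b hb, map_mul]
  let F := Algebra.adjoin ℚ (ρ '' (A : Set G))
  letI : CommRing F := Algebra.adjoinCommRingOfComm ℚ hc
  have hii : ∀ g x, ρ g⁻¹ * (ρ g * x) = x := fun g x => by
    rw [← mul_assoc, ← map_mul]; simp
  have hii' : ∀ g x, ρ g * (ρ g⁻¹ * x) = x := fun g x => by
    rw [← mul_assoc, ← map_mul]; simp
  have hi : ∀ g, ρ g * ρ g⁻¹ = 1 := fun g => by rw [← map_mul]; simp
  have hi' : ∀ g, ρ g⁻¹ * ρ g = 1 := fun g => by rw [← map_mul]; simp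
  have hmem : ∀ g, ∀ x ∈ F, ρ g * x * ρ g⁻¹ ∈ F := by
    intro g x hx
    refine Algebra.adjoin_induction ?_ ?_ ?_ ?_ hx
    · rintro _ ⟨a, ha, rfl⟩
      rw [← map_mul, ← map_mul]
      exact Algebra.subset_adjoin ⟨_, hA.conj_mem a ha g, rfl⟩
    · intro r
      rw [← Algebra.commutes, mul_assoc, hi, mul_one]
      exact F.algebraMap_mem r
    · intro x y _ _ hx hy
      rw [mul_add, add_mul]; exact add_mem hx hy
    · intro x y _ _ hx hy
      have : ρ g * (x * y) * ρ g⁻¹ = (ρ g * x * ρ g⁻¹) * (ρ g * y * ρ g⁻¹) := by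
        simp only [mul_assoc, hii]
      rw [this]; exact mul_mem hx hy
  have hmem' : ∀ g, ∀ x ∈ F, ρ g⁻¹ * x * ρ g ∈ F := by
    intro g x hx
    simpa using hmem g⁻¹ x hx
  let σ : G →* (F ≃ₐ[ℚ] F) :=
    { toFun := fun g =>
        { toFun := fun x => ⟨ρ g * x * ρ g⁻¹, hmem g x x.2⟩
          invFun := fun x => ⟨ρ g⁻¹ * x * ρ g, hmem' g x x.2⟩
          left_inv := fun x => by
            apply Subtype.ext
            simp only [mul_assoc, hii, hi', mul_one]
          right_inv := fun x => by
            apply Subtype.ext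
            simp only [mul_assoc, hii', hi, mul_one]
          map_mul' := fun x y => by
            apply Subtype.ext
            change ρ g * (x.1 * y.1) * ρ g⁻¹ = (ρ g * x.1 * ρ g⁻¹) * (ρ g * y.1 * ρ g⁻¹)
            simp only [mul_assoc, hii]
          map_add' := fun x y => by
            apply Subtype.ext
            change ρ g * (x.1 + y.1) * ρ g⁻¹ = (ρ g * x.1 * ρ g⁻¹) + (ρ g * y.1 * ρ g⁻¹)
            rw [mul_add, add_mul]
          commutes' := fun r => by
            apply Subtype.ext
            change ρ g * (algebraMap ℚ (Module.End ℚ V) r) * ρ g⁻¹ = algebraMap ℚ _ r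
            rw [← Algebra.commutes, mul_assoc, hi, mul_one] }
      map_one' := by
        ext x : 2
        change ρ 1 * x.1 * ρ 1⁻¹ = x.1
        simp
      map_mul' := fun g h => by
        ext x : 2
        change ρ (g * h) * x.1 * ρ (g * h)⁻¹ = ρ g * (ρ h * x.1 * ρ h⁻¹) * ρ g⁻¹
        simp only [_root_.mul_inv_rev, map_mul, mul_assoc] }
  have hσ : ∀ g (r : F) v, ρ g (r • v) = σ g r • ρ g v := by
    intro g r v
    change (ρ g) (r.1 v) = (ρ g * r.1 * ρ g⁻¹) (ρ g v)
    rw [← Module.End.mul_apply, ← Module.End.mul_apply, mul_assoc, hi', mul_one]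
  have hfin : FiniteDimensional ℚ F := inferInstance
  have hfaith : FaithfulSMul F V := ⟨fun {x y} h => Subtype.ext (LinearMap.ext h)⟩
  have hfield : IsField F := isField_of_primitive ρ σ hσ hirr hprim
  letI : Field F := hfield.toField
  refine solvable_of_field (E := F) ρ hρ σ hσ hV ?_
  intro h1
  obtain ⟨a, ha, hna⟩ := hns
  obtain ⟨c, hc⟩ := (finrank_eq_one_iff_of_nonzero' (1 : F) one_ne_zero).1 h1
    ⟨ρ a, Algebra.subset_adjoin ⟨a, ha, rfl⟩⟩
  exact hna c (congrArg Subtype.val hc).symm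

/-- A nontrivial solvable normal subgroup contains a nontrivial abelian normal subgroup. -/
theorem exists_abelian_normal (N : Subgroup G) [N.Normal] [hs : Group.IsSolvable N] (hN : N ≠ ⊥) :
    ∃ A : Subgroup G, A.Normal ∧ A ≤ N ∧ A ≠ ⊥ ∧ ∀ a ∈ A, ∀ b ∈ A, a * b = b * a := by
  classical
  have hex := (Group.isSolvable_def N).1 hs
  have hspec := Nat.find_spec hex
  obtain ⟨k, hk⟩ : ∃ k, Nat.find hex = k + 1 := by
    refine Nat.exists_eq_succ_of_ne_zero fun h0 => hN ?_
    rw [h0, derivedSeries_zero] at hspec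
    rw [eq_bot_iff]
    intro x hx
    have : (⟨x, hx⟩ : N) ∈ (⊤ : Subgroup N) := trivial
    rw [hspec, Subgroup.mem_bot] at this
    exact congrArg Subtype.val this
  have hne : derivedSeries N k ≠ ⊥ := Nat.find_min hex (by omega)
  rw [hk, derivedSeries_succ] at hspec
  refine ⟨(derivedSeries N k).map N.subtype, inferInstance, ?_, ?_, ?_⟩
  · rintro _ ⟨x, _, rfl⟩; exact x.2
  · rwa [Ne, Subgroup.map_eq_bot_iff_of_injective _ N.subtype_injective]
  · rintro _ ⟨x, hx, rfl⟩ _ ⟨y, hy, rfl⟩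
    have := Subgroup.commutator_mem_commutator hx hy
    rw [hspec, Subgroup.mem_bot, commutatorElement_eq_one_iff_mul_comm] at this
    rw [← map_mul, this, map_mul]

end PrimSolv

/-- For prime `n`, an infinite solvable-by-finite primitive subgroup of
`SL(n,ℤ)` is solvable. -/
theorem primitive_solvable_by_finite_is_solvable (n : ℕ) (hn : n.Prime)
    (H : Subgroup (SL n ℤ)) (hinf : Infinite H) (hsbf : SolvableByFinite H)
    (hprim : PrimitiveQ H) :
    IsSolvable H := by
  obtain ⟨K, hK, hKf⟩ := hsbf
  have hK' : Group.IsSolvable K := hK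
  let φ : SL n ℤ →* Matrix (Fin n) (Fin n) ℚ :=
    { toFun := matQ
      map_one' := by
        ext i j
        simp [matQ, Matrix.one_apply]
      map_mul' := fun a b => by
        simp only [matQ, Matrix.SpecialLinearGroup.coe_mul]
        exact Matrix.map_mul (f := Int.castRingHom ℚ) }
  let ρ : H →* Module.End ℚ (Fin n → ℚ) :=
    ((Matrix.toLinAlgEquiv' : Matrix (Fin n) (Fin n) ℚ ≃ₐ[ℚ] _) : _ →* _).comp (φ.comp H.subtype)
  have hρa : ∀ h : H, ρ h = Matrix.toLin' (matQ h.1) := fun h => rfl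
  have hφ : Function.Injective φ := by
    intro a b h
    ext i j
    have : ((a.1 i j : ℤ) : ℚ) = ((b.1 i j : ℤ) : ℚ) := congrFun (congrFun h i) j
    exact_mod_cast this
  have hρ : Function.Injective ρ := by
    intro a b h
    rw [hρa, hρa] at h
    exact Subtype.ext (hφ (Matrix.toLin'.injective h))
  -- a normal solvable subgroup of finite index, trivial mod 3
  let N : Subgroup H := K.normalCore ⊓ ((redMod n 3).comp H.subtype).ker
  have hNn : N.Normal := inferInstance
  have hNs : Group.IsSolvable N :=
    Group.isSolvable_of_isSolvable_injective (f := Subgroup.inclusion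
      ((inf_le_left : N ≤ _).trans K.normalCore_le)) (Subgroup.inclusion_injective _)
  have hNf : N.FiniteIndex := inferInstance
  have hNne : N ≠ ⊥ := by
    intro h
    rw [h] at hNf
    have := hNf.index_ne_zero
    rw [Subgroup.index_bot] at this
    exact this Nat.card_eq_zero_of_infinite
  obtain ⟨A, hAn, hAN, hAne, hAc⟩ := PrimSolv.exists_abelian_normal N hNne
  obtain ⟨⟨a, ha⟩, hane'⟩ := Subgroup.ne_bot_iff_exists_ne_one.1 hAne
  have hane : a ≠ 1 := fun h => hane' (Subtype.ext h)
  refine PrimSolv.solvable_of_normal_abelian ρ hρ (by simpa using hn) ?_ ?_ A hAc ⟨a, ha, ?_⟩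
  · intro W hW
    exact hprim.1 W fun g hg => hW ⟨g, hg⟩
  · rintro ⟨m, hm, W, h1, h2, h3⟩
    exact hprim.2 ⟨m, hm, W, h1, h2, fun g hg => h3 ⟨g, hg⟩⟩
  · intro c hc
    apply hane
    have hM : matQ a.1 = c • 1 := by
      apply Matrix.toLin'.injective
      rw [← hρa, hc]
      simp [Module.End.one_eq_id]
    have hentry : ∀ i j, ((a.1.1 i j : ℤ) : ℚ) = c * (1 : Matrix (Fin n) (Fin n) ℚ) i j :=
      fun i j => congrFun (congrFun hM i) j
    let i0 : Fin n := ⟨0, hn.pos⟩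
    have hd : a.1.1 = Matrix.diagonal fun _ => a.1.1 i0 i0 := by
      ext i j
      have h0 := hentry i0 i0
      have h1 := hentry i j
      rw [Matrix.one_apply_eq, mul_one] at h0
      rw [← h0] at h1
      by_cases hij : i = j
      · subst hij
        rw [Matrix.one_apply_eq, mul_one] at h1
        rw [Matrix.diagonal_apply_eq]
        exact_mod_cast h1
      · rw [Matrix.one_apply_ne hij, mul_zero] at h1
        rw [Matrix.diagonal_apply_ne _ hij]
        exact_mod_cast h1
    have hdet : (a.1.1 i0 i0) ^ n = 1 := by
      have := a.1.2
      rw [hd, Matrix.det_diagonal] at this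
      simpa using this
    have hmod : ((a.1.1 i0 i0 : ℤ) : ZMod 3) = 1 := by
      have h : redMod n 3 a.1 = 1 := (hAN ha).2
      have h2 := congrArg (fun M : SL n (ZMod 3) => M.1 i0 i0) h
      simpa [redMod] using h2
    have hu : a.1.1 i0 i0 = 1 := by
      have : IsUnit (a.1.1 i0 i0) := IsUnit.of_pow_eq_one hdet hn.ne_zero
      rcases Int.isUnit_iff.1 this with h | h
      · exact h
      · rw [h] at hmod
        exact absurd hmod (by decide)
    apply Subtype.ext
    apply Subtype.ext
    rw [hd, hu]
    simp
end

section
/- Let n be a prime. If H ≤ SL(n,ℤ) is a finitely generated subgroup that is infinite, non-solvable, and primitive (acting on ℚ^n), then for all but finitely many primes p, the image φ_p(H) is a primitive subgroup of SL(n,ℤ/pℤ) (acting on (ℤ/pℤ)^n). -/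
open Matrix

set_option linter.style.haveILetI false
set_option linter.unusedSimpArgs false

/-- Two elements of `SL(n,ℤ)` that agree modulo infinitely many numbers are equal. -/
theorem eq_of_redMod_eq {n : ℕ} {S : Set ℕ} (hS : S.Infinite) (a b : SL n ℤ)
    (h : ∀ p ∈ S, redMod n p a = redMod n p b) : a = b := by
  ext i j
  by_contra hne
  apply hS
  refine (Set.finite_Iic ((b i j - a i j).natAbs)).subset fun p hp => ?_
  have h1 : ((a i j : ℤ) : ZMod p) = ((b i j : ℤ) : ZMod p) := by
    have := congrArg (fun g : SL n (ZMod p) => g i j) (h p hp)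
    simpa [redMod] using this
  rw [ZMod.intCast_eq_intCast_iff_dvd_sub] at h1
  have h2 : p ∣ (b i j - a i j).natAbs := Int.natCast_dvd.mp h1
  exact Nat.le_of_dvd (by omega) h2

/-- The natural representation on `ℚ^n`. -/
noncomputable def rhoQ (n : ℕ) : SL n ℤ →* Module.End ℚ (Fin n → ℚ) where
  toFun g := Matrix.toLin' (matQ g)
  map_one' := by
    have : matQ (1 : SL n ℤ) = 1 := by
      simp [matQ]
    rw [this, Matrix.toLin'_one]; rfl
  map_mul' a b := by
    have : matQ (a * b) = matQ a * matQ b := by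
      have := Matrix.map_mul (L := a.1) (M := b.1) (f := Int.castRingHom ℚ)
      simpa [matQ] using this
    rw [this, Matrix.toLin'_mul]; rfl

theorem rhoQ_inj (n : ℕ) : Function.Injective (rhoQ n) := by
  intro a b h
  have h1 : matQ a = matQ b := Matrix.toLin'.injective h
  ext i j
  have := congrFun (congrFun h1 i) j
  simpa [matQ] using this

theorem lin_comm_of_field {n : ℕ} (hn : n.Prime) {V E : Type*} [AddCommGroup V] [Module ℚ V]
    [CommRing E] [Algebra ℚ E] [Module E V] [IsScalarTower ℚ E V] (hE : IsField E)
    (hV : Module.finrank ℚ V = n) (h1 : Module.finrank ℚ E ≠ 1)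
    (f g : Module.End ℚ V) (hf : ∀ (e : E) v, f (e • v) = e • f v)
    (hg : ∀ (e : E) v, g (e • v) = e • g v) : f * g = g * f := by
  letI := hE.toField
  have h2 := Module.finrank_mul_finrank ℚ E V
  rw [hV] at h2
  have h3 : Module.finrank E V = 1 := by
    rcases (Nat.prime_mul_iff (a := Module.finrank ℚ E) (b := Module.finrank E V)).1 (h2 ▸ hn) with h | h
    · exact h.2
    · exact absurd h.2 h1
  obtain ⟨v, hv, hspan⟩ := finrank_eq_one_iff'.1 h3
  ext w
  obtain ⟨a, ha⟩ := hspan (f v)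
  obtain ⟨b, hb⟩ := hspan (g v)
  obtain ⟨c, rfl⟩ := hspan w
  simp only [Module.End.mul_apply, hf, hg, ← ha, ← hb, smul_smul]
  congr 1
  ring

/-- Absolute irreducibility. -/
theorem absIrred {n : ℕ} (hn : n.Prime) (H : Subgroup (SL n ℤ))
    (hirr : IrreducibleQ H) (hnc : ∃ a ∈ H, ∃ b ∈ H, a * b ≠ b * a) :
    Algebra.adjoin ℚ (rhoQ n '' (H : Set (SL n ℤ))) = ⊤ := by
  set A := Algebra.adjoin ℚ (rhoQ n '' (H : Set (SL n ℤ))) with hA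
  have hmem : ∀ g ∈ H, rhoQ n g ∈ A := fun g hg => Algebra.subset_adjoin ⟨g, hg, rfl⟩
  haveI : Fact n.Prime := ⟨hn⟩
  haveI : NeZero n := ⟨hn.ne_zero⟩
  have hsimple : IsSimpleModule A (Fin n → ℚ) := by
    haveI : Nontrivial (Submodule A (Fin n → ℚ)) := inferInstance
    refine { eq_bot_or_eq_top := fun W => ?_ }
    rcases hirr (W.restrictScalars ℚ) (by
      rintro g hg _ ⟨v, hv, rfl⟩
      exact W.smul_mem (⟨rhoQ n g, hmem g hg⟩ : A) hv) with h | h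
    · left; simpa using h
    · right; simpa using h
  by_cases hD : ∀ d : Module.End A (Fin n → ℚ), ∃ c : ℚ, ∀ v, d v = c • v
  · rw [eq_top_iff]
    rintro f -
    let F : Module.End (Module.End A (Fin n → ℚ)) (Fin n → ℚ) :=
      { toFun := f
        map_add' := f.map_add
        map_smul' := by
          intro d v
          obtain ⟨c, hc⟩ := hD d
          simp [Module.End.smul_def, hc] }
    obtain ⟨r, hr⟩ := jacobson_density (R := A) F
      (Finset.univ.image fun i : Fin n => (Pi.single i 1 : Fin n → ℚ))
    have : f = r.1 := by
      refine (Pi.basisFun ℚ (Fin n)).ext fun i => ?_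
      have := hr (Pi.single i 1) (by simp)
      rw [Pi.basisFun_apply]; exact this
    rw [this]; exact r.2
  · exfalso
    push Not at hD
    obtain ⟨d, hd⟩ := hD
    let d' : Module.End ℚ (Fin n → ℚ) := d.restrictScalars ℚ
    let E := Algebra.adjoin ℚ {d'}
    haveI : IsMulCommutative E := Algebra.isMulCommutative_adjoin ℚ (by
      rintro x rfl y rfl; rfl)
    have hcomm : ∀ e ∈ E, ∀ g ∈ H, e * rhoQ n g = rhoQ n g * e := by
      intro e he g hg
      have : E ≤ Subalgebra.centralizer ℚ {rhoQ n g} := by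
        refine Algebra.adjoin_le ?_
        rintro x rfl
        rw [SetLike.mem_coe, Subalgebra.mem_centralizer_iff]
        rintro y rfl
        refine LinearMap.ext fun v => ?_
        exact (d.map_smul (⟨rhoQ n g, hmem g hg⟩ : A) _).symm
      exact (((Subalgebra.mem_centralizer_iff ℚ).1 (this he)) _ rfl).symm
    have hinj : ∀ e ∈ E, e ≠ 0 → LinearMap.ker e = ⊥ := by
      intro e he h0
      rcases hirr (LinearMap.ker e) (by
        rintro g hg _ ⟨v, hv, rfl⟩
        have := LinearMap.congr_fun (hcomm e he g hg) v
        have hv' : e v = 0 := hv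
        change e (rhoQ n g v) = 0
        simpa [hv'] using this) with h | h
      · exact h
      · exact absurd (LinearMap.ker_eq_top.1 h) h0
    haveI : IsDomain E := by
      haveI : NoZeroDivisors E := by
        refine ⟨fun {a b} hab => ?_⟩
        by_contra! hcon
        have h1 := hinj a.1 a.2 (by simpa using hcon.1)
        apply hcon.2
        ext1
        refine LinearMap.ext fun v => ?_
        have h2 : a.1 (b.1 v) = 0 := LinearMap.congr_fun (congrArg Subtype.val hab) v
        exact (LinearMap.ker_eq_bot'.1 h1) _ h2
      exact NoZeroDivisors.to_isDomain E
    haveI : IsArtinianRing E := IsArtinianRing.of_finite ℚ E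
    have hfield : IsField E := IsArtinianRing.isField_of_isDomain E
    obtain ⟨a, ha, b, hb, hab⟩ := hnc
    apply hab
    apply rhoQ_inj
    rw [map_mul, map_mul]
    refine lin_comm_of_field (E := E) hn hfield (by simp) ?_ _ _
      (fun e v => ?_) (fun e v => ?_)
    · intro h1
      haveI : Module.Free ℚ E := Module.Free.of_divisionRing ℚ E
      replace h1 := (Subalgebra.bot_eq_top_iff_finrank_eq_one (F := ℚ) (E := E)).2 h1
      have h3 : (⟨d', Algebra.subset_adjoin rfl⟩ : E) ∈ (⊥ : Subalgebra ℚ E) := by rw [h1]; trivial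
      obtain ⟨c, hc⟩ := Algebra.mem_bot.1 h3
      obtain ⟨v, hv⟩ := hd c
      apply hv
      have := LinearMap.congr_fun (congrArg Subtype.val hc) v
      exact this.symm
    · exact (LinearMap.congr_fun (hcomm e.1 e.2 a ha) v).symm
    · exact (LinearMap.congr_fun (hcomm e.1 e.2 b hb) v).symm

/-- A commutative algebra acting faithfully and normalised by a primitive group is a field. -/
theorem isField_of_primitive {n : ℕ} (hn : n ≠ 0) (H : Subgroup (SL n ℤ)) (hprim : PrimitiveQ H)
    {E : Type} [CommRing E] [Algebra ℚ E] [Module.Finite ℚ E] [Module E (Fin n → ℚ)]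
    [IsScalarTower ℚ E (Fin n → ℚ)]
    (hfaith : ∀ e : E, (∀ v : Fin n → ℚ, e • v = 0) → e = 0)
    (σ : H →* (E ≃ₐ[ℚ] E))
    (hσ : ∀ (h : H) (e : E) (v : Fin n → ℚ), rhoQ n h (e • v) = σ h e • rhoQ n h v) :
    IsField E := by
  classical
  obtain ⟨hirr, hnimp⟩ := hprim
  haveI : NeZero n := ⟨hn⟩
  haveI : IsArtinianRing E := IsArtinianRing.of_finite ℚ E
  haveI : Module.Finite E (Fin n → ℚ) := Module.Finite.of_restrictScalars_finite ℚ E _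
  have hinvr : ∀ (h : H) (v : Fin n → ℚ), rhoQ n h (rhoQ n (h⁻¹ : H) v) = v := by
    intro h v
    rw [← Module.End.mul_apply, ← map_mul]; simp
  -- the nilradical vanishes
  have hnil : nilradical E = ⊥ := by
    let W : Submodule E (Fin n → ℚ) := nilradical E • ⊤
    rcases hirr (W.restrictScalars ℚ) (by
      rintro g hg _ ⟨v, hv, rfl⟩
      have hv' : v ∈ nilradical E • (⊤ : Submodule E (Fin n → ℚ)) := hv
      change rhoQ n g v ∈ nilradical E • (⊤ : Submodule E (Fin n → ℚ))
      refine Submodule.smul_induction_on hv' ?_ ?_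
      · intro r hr m _
        have := hσ ⟨g, hg⟩ r m
        change rhoQ n g (r • m) = _ at this
        rw [this]
        refine Submodule.smul_mem_smul ?_ trivial
        rw [mem_nilradical] at hr ⊢
        exact hr.map (σ ⟨g, hg⟩)
      · intro x y hx hy
        rw [map_add]; exact Submodule.add_mem _ hx hy) with h | h
    · rw [eq_bot_iff]
      intro e he
      apply hfaith
      intro v
      have : e • v ∈ W.restrictScalars ℚ :=
        (Submodule.smul_mem_smul he trivial : e • v ∈ nilradical E • (⊤ : Submodule E (Fin n → ℚ)))
      rw [h] at this
      simpa using this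
    · exfalso
      have h1 : W = ⊤ := by simpa using h
      have := Submodule.eq_bot_of_le_smul_of_le_jacobson_bot (nilradical E)
        (⊤ : Submodule E (Fin n → ℚ)) Module.Finite.fg_top h1.ge (by
          rw [nilradical]; exact Ideal.radical_le_jacobson)
      exact top_ne_bot this
  letI : Fintype (MaximalSpectrum E) := Fintype.ofFinite _
  let W : MaximalSpectrum E → Submodule E (Fin n → ℚ) :=
    fun I => Submodule.torsionBySet E (Fin n → ℚ) I.asIdeal
  have hmemW : ∀ I v, v ∈ W I ↔ ∀ e ∈ I.asIdeal, e • v = 0 := by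
    intro I v
    simp only [W, Submodule.mem_torsionBySet_iff]
    exact ⟨fun h e he => h ⟨e, he⟩, fun h e => h e.1 e.2⟩
  have hcop : ((Finset.univ : Finset (MaximalSpectrum E)) : Set (MaximalSpectrum E)).Pairwise
      fun i j => i.asIdeal ⊔ j.asIdeal = ⊤ := by
    intro I _ J _ hIJ
    exact Ideal.isCoprime_iff_sup_eq.1 (Ideal.isCoprime_of_isMaximal (fun h => hIJ (MaximalSpectrum.ext h)))
  have hind : iSupIndep W := by
    rw [iSupIndep_iff_supIndep_univ]
    exact Submodule.supIndep_torsionBySet_ideal hcop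
  have hsup : iSup W = ⊤ := by
    have h1 := Submodule.iSup_torsionBySet_ideal_eq_torsionBySet_iInf (M := Fin n → ℚ) hcop
    simp only [Finset.mem_univ, iSup_pos, iInf_pos] at h1
    change (⨆ i, W i) = _ at h1
    rw [h1, eq_top_iff]
    intro v _
    rw [Submodule.mem_torsionBySet_iff]
    rintro ⟨e, he⟩
    have : e ∈ nilradical E := by
      rw [nilradical, ← IsArtinianRing.jacobson_eq_radical, Ideal.jacobson, Ideal.mem_sInf]
      rintro M ⟨-, hM⟩
      have he' : e ∈ ⨅ i : MaximalSpectrum E, i.asIdeal := he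
      exact (Ideal.mem_iInf.1 he') ⟨M, hM⟩
    rw [hnil] at this
    have : e = 0 := this
    simp [this]
  have hperm : ∀ (g : H) I, ∃ J, ((W I).restrictScalars ℚ).map (rhoQ n g) =
      (W J).restrictScalars ℚ := by
    intro g I
    have hmax : (I.asIdeal.comap (σ g⁻¹ : E ≃ₐ[ℚ] E)).IsMaximal :=
      haveI := I.isMaximal
      Ideal.comap_isMaximal_of_equiv (σ g⁻¹ : E ≃ₐ[ℚ] E)
    refine ⟨⟨_, hmax⟩, le_antisymm ?_ ?_⟩
    · rintro _ ⟨v, hv, rfl⟩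
      have hv' := (hmemW I v).1 hv
      refine (hmemW _ _).2 fun e he => ?_
      have he' : σ g⁻¹ e ∈ I.asIdeal := he
      have h1 := hσ g (σ g⁻¹ e) v
      rw [hv' _ he', map_zero, ← AlgEquiv.mul_apply, ← map_mul] at h1
      simpa using h1.symm
    · intro x hx
      have hx' := (hmemW ⟨_, hmax⟩ x).1 hx
      refine ⟨rhoQ n (g⁻¹ : H) x, (hmemW _ _).2 fun e he => ?_, hinvr g x⟩
      have h1 := hσ g⁻¹ (σ g e) x
      rw [← AlgEquiv.mul_apply, ← map_mul] at h1
      have h2 : σ g e • x = 0 := hx' _ (by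
        change σ g⁻¹ (σ g e) ∈ I.asIdeal
        rw [← AlgEquiv.mul_apply, ← map_mul]; simpa using he)
      rw [h2] at h1
      simpa using h1.symm
  by_cases hex : ∃ I, W I = ⊤
  · obtain ⟨I, hI⟩ := hex
    have hbot : I.asIdeal = ⊥ := by
      rw [eq_bot_iff]
      intro e he
      exact hfaith e fun v => (hmemW I v).1 (hI ▸ trivial) e he
    have hbm := I.isMaximal
    rw [hbot] at hbm
    haveI : Nontrivial E := ⟨0, 1, fun h => hbm.ne_top ((Ideal.eq_top_iff_one _).2 (by simp [← h]))⟩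
    exact Ring.isField_iff_maximal_bot.2 hbm
  · exfalso
    push Not at hex
    let J := {I : MaximalSpectrum E // W I ≠ ⊥}
    apply hnimp
    have e : Fin (Fintype.card J) ≃ J := (Fintype.equivFin J).symm
    have hindJ : iSupIndep (fun I : J => W I.1) := hind.comp Subtype.val_injective
    have hsupJ : (⨆ I : J, W I.1) = ⊤ := by
      rw [eq_top_iff, ← hsup]
      refine iSup_le fun I => ?_
      by_cases h : W I = ⊥
      · rw [h]; exact bot_le
      · exact le_iSup (fun I : J => W I.1) ⟨I, h⟩
    have hint : DirectSum.IsInternal (fun k => W (e k).1) := by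
      rw [DirectSum.isInternal_submodule_iff_iSupIndep_and_iSup_eq_top]
      refine ⟨hindJ.comp e.injective, ?_⟩
      rw [← hsupJ]
      exact e.iSup_comp (g := fun I : J => W I.1)
    refine ⟨Fintype.card J, ?_, fun k => (W (e k).1).restrictScalars ℚ, ?_, hint, ?_⟩
    · by_contra hlt
      have hss : Subsingleton J := by
        rw [← Fintype.card_le_one_iff_subsingleton]; omega
      rcases isEmpty_or_nonempty J with hem | ⟨⟨I⟩⟩
      · rw [iSup_of_empty] at hsupJ
        exact bot_ne_top hsupJ
      · apply hex I.1
        rw [← hsupJ]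
        refine le_antisymm (le_iSup (fun I : J => W I.1) I) (iSup_le fun I' => ?_)
        rw [Subsingleton.elim I' I]
    · intro k h
      exact (e k).2 (by simpa using h)
    · intro g hg k
      obtain ⟨I', hI'⟩ := hperm ⟨g, hg⟩ (e k).1
      have hne : W I' ≠ ⊥ := by
        intro h0
        rw [h0] at hI'
        apply (e k).2
        rw [eq_bot_iff]
        intro v hv
        have h1 : rhoQ n g v ∈ (⊥ : Submodule E (Fin n → ℚ)).restrictScalars ℚ := by
          rw [← hI']; exact ⟨v, hv, rfl⟩
        have h2 : rhoQ n g v = 0 := by simpa using h1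
        have h3 := hinvr (⟨g, hg⟩⁻¹ : H) v
        rw [inv_inv] at h3
        change rhoQ n _ (rhoQ n g v) = v at h3
        rw [h2, map_zero] at h3
        simp [← h3]
      refine ⟨e.symm ⟨I', hne⟩, ?_⟩
      simp only [Equiv.apply_symm_apply]
      exact hI'

/-- Conjugation by an element of the group, as an algebra endomorphism. -/
noncomputable def conjQ {n : ℕ} (h : SL n ℤ) :
    Module.End ℚ (Fin n → ℚ) →ₐ[ℚ] Module.End ℚ (Fin n → ℚ) where
  toFun f := rhoQ n h * f * rhoQ n h⁻¹
  map_one' := by rw [mul_one, ← map_mul, mul_inv_cancel, map_one]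
  map_mul' f g := by
    have : rhoQ n h⁻¹ * rhoQ n h = 1 := by rw [← map_mul, inv_mul_cancel, map_one]
    calc rhoQ n h * (f * g) * rhoQ n h⁻¹ = rhoQ n h * f * 1 * g * rhoQ n h⁻¹ := by
          simp only [mul_assoc, one_mul]
      _ = _ := by rw [← this]; simp only [mul_assoc]
  map_zero' := by simp
  map_add' f g := by simp only [mul_add, add_mul]
  commutes' r := by
    rw [← Algebra.commutes, mul_assoc, ← map_mul, mul_inv_cancel, map_one, mul_one]

theorem conjQ_apply {n : ℕ} (h : SL n ℤ) (f : Module.End ℚ (Fin n → ℚ)) :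
    conjQ h f = rhoQ n h * f * rhoQ n h⁻¹ := rfl

theorem finrank_field_eq {n : ℕ} (hn : n.Prime) {E : Type} [CommRing E] [Algebra ℚ E]
    [Module E (Fin n → ℚ)] [IsScalarTower ℚ E (Fin n → ℚ)] (hE : IsField E)
    (h1 : Module.finrank ℚ E ≠ 1) : Module.finrank ℚ E = n := by
  letI := hE.toField
  have h2 := Module.finrank_mul_finrank ℚ E (Fin n → ℚ)
  rw [Module.finrank_fin_fun] at h2
  exact ((Nat.dvd_prime hn).1 ⟨_, h2.symm⟩).resolve_left h1

theorem solvable_aut {n : ℕ} (hn : n.Prime) {E : Type} [CommRing E] [Algebra ℚ E]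
    [Module.Finite ℚ E] (hE : IsField E) (hdim : Module.finrank ℚ E = n) :
    Group.IsSolvable (E ≃ₐ[ℚ] E) := by
  letI := hE.toField
  have h1 := IntermediateField.finrank_fixedField_eq_card (F := ℚ) (E := E) ⊤
  have h2 := Module.finrank_mul_finrank ℚ
    (IntermediateField.fixedField (⊤ : Subgroup (E ≃ₐ[ℚ] E))) E
  rw [h1, hdim] at h2
  have h3 : Nat.card (⊤ : Subgroup (E ≃ₐ[ℚ] E)) ∣ n := ⟨_, by rw [← h2, mul_comm]⟩
  rw [Subgroup.card_top] at h3
  haveI : Fact n.Prime := ⟨hn⟩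
  rcases (Nat.dvd_prime hn).1 h3 with h | h
  · haveI := (Nat.card_eq_one_iff_unique.1 h).1
    infer_instance
  · haveI := isCyclic_of_prime_card h
    exact Group.isSolvable_of_comm (fun a b => by
      letI := IsCyclic.commGroup (α := E ≃ₐ[ℚ] E)
      exact mul_comm a b)

set_option maxHeartbeats 1000000 in
open scoped IsMulCommutative in
theorem no_abelian_aux {n : ℕ} (hn : n.Prime) (H : Subgroup (SL n ℤ)) (hinf : Infinite H)
    (hns : ¬ Group.IsSolvable H) (hprim : PrimitiveQ H) (K : Subgroup H)
    [K.FiniteIndex] (E : Subalgebra ℚ (Module.End ℚ (Fin n → ℚ))) [IsMulCommutative E]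
    (hmem : ∀ k ∈ K, rhoQ n k ∈ E)
    (hconj : ∀ (h : H) (e : E), conjQ (h : SL n ℤ) e.1 ∈ E) : False := by
  haveI : NeZero n := ⟨hn.ne_zero⟩
  let σ₀ : H →* (E →ₐ[ℚ] E) :=
    { toFun := fun h => ((conjQ (h : SL n ℤ)).comp E.val).codRestrict E (hconj h)
      map_one' := by
        ext1 e
        apply Subtype.ext
        change rhoQ n (1 : SL n ℤ) * e.1 * rhoQ n (1 : SL n ℤ)⁻¹ = e.1
        simp
      map_mul' := by
        intro a b
        ext1 e
        apply Subtype.ext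
        change rhoQ n (a * b : SL n ℤ) * e.1 * rhoQ n (a * b : SL n ℤ)⁻¹ =
          rhoQ n a * (rhoQ n b * e.1 * rhoQ n (b : SL n ℤ)⁻¹) * rhoQ n (a : SL n ℤ)⁻¹
        simp only [_root_.mul_inv_rev, map_mul, mul_assoc] }
  let σ : H →* (E ≃ₐ[ℚ] E) := (AlgEquiv.algHomUnitsEquiv ℚ E).toMonoidHom.comp σ₀.toHomUnits
  have hσv : ∀ (h : H) (e : E), (σ h e).1 = rhoQ n h * e.1 * rhoQ n (h : SL n ℤ)⁻¹ :=
    fun h e => rfl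
  have hσ : ∀ (h : H) (e : E) (v : Fin n → ℚ), rhoQ n h (e • v) = σ h e • rhoQ n h v := by
    intro h e v
    change rhoQ n h (e.1 v) = (σ h e).1 (rhoQ n h v)
    rw [hσv]
    have : rhoQ n (h : SL n ℤ)⁻¹ * rhoQ n h = 1 := by rw [← map_mul, inv_mul_cancel, map_one]
    have := LinearMap.congr_fun this v
    simp only [Module.End.mul_apply] at this ⊢
    rw [this]; rfl
  have hfield : IsField E := isField_of_primitive hn.ne_zero H hprim (E := E)
    (fun e he => Subtype.ext (LinearMap.ext he)) σ hσ
  by_cases h1 : Module.finrank ℚ E = 1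
  · -- scalars
    haveI : Module.Free ℚ E := Module.Free.of_divisionRing ℚ E
    replace h1 := (Subalgebra.bot_eq_top_iff_finrank_eq_one (F := ℚ) (E := E)).2 h1
    have hsc : ∀ k ∈ K, ∃ c : ℚ, rhoQ n k = algebraMap ℚ _ c := by
      intro k hk
      have h3 : (⟨rhoQ n k, hmem k hk⟩ : E) ∈ (⊥ : Subalgebra ℚ E) := by rw [h1]; trivial
      obtain ⟨c, hc⟩ := Algebra.mem_bot.1 h3
      exact ⟨c, (congrArg Subtype.val hc).symm⟩
    have hsc' : ∀ k ∈ K, ∃ c : ℤ, (k : SL n ℤ).1 = c • (1 : Matrix (Fin n) (Fin n) ℤ) := by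
      intro k hk
      obtain ⟨c, hc⟩ := hsc k hk
      have h4 : matQ (k : SL n ℤ) = c • (1 : Matrix (Fin n) (Fin n) ℚ) := by
        apply Matrix.toLin'.injective
        rw [map_smul, Matrix.toLin'_one]
        exact hc.trans (Algebra.algebraMap_eq_smul_one c)
      have h5 : ∀ i j, (((k : SL n ℤ) i j : ℤ) : ℚ) = c * (1 : Matrix (Fin n) (Fin n) ℚ) i j := by
        intro i j
        have := congrFun (congrFun h4 i) j
        simpa [matQ] using this
      refine ⟨(k : SL n ℤ) 0 0, ?_⟩
      ext i j
      have h6 := h5 i j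
      have h7 := h5 0 0
      have : (((k : SL n ℤ) i j : ℤ) : ℚ) = (((k : SL n ℤ) 0 0 : ℤ) : ℚ) * (1 : Matrix (Fin n) (Fin n) ℚ) i j := by
        rw [h6, h7]; simp
      simp only [Matrix.one_apply] at this
      simp only [Matrix.smul_apply, Matrix.one_apply, smul_eq_mul]
      split_ifs at this ⊢ <;> simpa using this
    have hfin : Finite K := by
      choose c hc using hsc'
      have hu : ∀ k : K, IsUnit (c k.1 k.2) := by
        intro k
        have hdet := (k.1 : SL n ℤ).2
        rw [hc k.1 k.2, Matrix.det_smul, Matrix.det_one, mul_one] at hdet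
        exact IsUnit.of_pow_eq_one hdet (by simp [hn.ne_zero])
      refine Finite.of_injective (fun k : K => (hu k).unit) ?_
      intro a b hab
      have h8 : c a.1 a.2 = c b.1 b.2 := congrArg Units.val hab
      apply Subtype.ext
      apply Subtype.ext
      apply Subtype.ext
      rw [hc a.1 a.2, hc b.1 b.2, h8]
    haveI : Finite (H ⧸ K) := K.finite_quotient_of_finiteIndex
    haveI : Finite H := Finite.of_equiv _ (Subgroup.groupEquivQuotientProdSubgroup (s := K)).symm
    exact not_finite H
  · apply hns
    have hdim : Module.finrank ℚ E = n := finrank_field_eq hn (E := E) hfield h1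
    haveI := solvable_aut (E := E) hn hfield hdim
    have hkercomm : ∀ a b : σ.ker, a * b = b * a := by
      intro a b
      have hlin : ∀ (x : σ.ker) (e : E) (v : Fin n → ℚ), rhoQ n x.1 (e • v) = e • rhoQ n x.1 v := by
        intro x e v
        rw [hσ, (MonoidHom.mem_ker).1 x.2]; rfl
      apply Subtype.ext
      apply Subtype.ext
      apply rhoQ_inj
      have := lin_comm_of_field (E := E) hn hfield (by simp) h1 (rhoQ n a.1) (rhoQ n b.1)
        (hlin a) (hlin b)
      simpa using this
    haveI : Group.IsSolvable σ.ker := Group.isSolvable_of_comm hkercomm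
    exact Group.isSolvable_of_ker_le_range σ.ker.subtype σ (by simp)

theorem no_abelian {n : ℕ} (hn : n.Prime) (H : Subgroup (SL n ℤ)) (hinf : Infinite H)
    (hns : ¬ Group.IsSolvable H) (hprim : PrimitiveQ H) (K : Subgroup H) [K.Normal]
    [K.FiniteIndex] (hK : ∀ a ∈ K, ∀ b ∈ K, a * b = b * a) : False := by
  let s : Set (Module.End ℚ (Fin n → ℚ)) := (fun k : H => rhoQ n k) '' K
  let E := Algebra.adjoin ℚ s
  haveI : IsMulCommutative E := Algebra.isMulCommutative_adjoin ℚ (by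
    rintro _ ⟨a, ha, rfl⟩ _ ⟨b, hb, rfl⟩
    have := congrArg (fun x : H => rhoQ n x) (hK a ha b hb)
    simpa using this)
  have hmem : ∀ k ∈ K, rhoQ n k ∈ E := fun k hk => Algebra.subset_adjoin ⟨k, hk, rfl⟩
  refine no_abelian_aux hn H hinf hns hprim K E hmem ?_
  intro h e
  have : E ≤ E.comap (conjQ (h : SL n ℤ)) := by
    refine Algebra.adjoin_le ?_
    rintro _ ⟨k, hk, rfl⟩
    have h1 := hmem _ (Subgroup.Normal.conj_mem ‹K.Normal› k hk h)
    simpa [conjQ_apply] using h1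
  exact this e.2

theorem exists_int_multiple {n : ℕ} (H : Subgroup (SL n ℤ)) (f : Module.End ℚ (Fin n → ℚ))
    (hf : f ∈ Algebra.adjoin ℚ (rhoQ n '' (H : Set (SL n ℤ)))) :
    ∃ N : ℕ, N ≠ 0 ∧ ∃ x ∈ Algebra.adjoin ℤ
      ((fun g : SL n ℤ => (g : Matrix (Fin n) (Fin n) ℤ)) '' (H : Set (SL n ℤ))),
      (N : ℚ) • f = Matrix.toLin' (x.map (Int.castRingHom ℚ)) := by
  induction hf using Algebra.adjoin_induction with
  | mem f hf =>
    obtain ⟨g, hg, rfl⟩ := hf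
    exact ⟨1, one_ne_zero, g.1, Algebra.subset_adjoin ⟨g, hg, rfl⟩, by rw [Nat.cast_one, one_smul]; rfl⟩
  | algebraMap r =>
    refine ⟨r.den, r.den_ne_zero, algebraMap ℤ _ r.num, Subalgebra.algebraMap_mem _ _, ?_⟩
    have h1 : (algebraMap ℤ (Matrix (Fin n) (Fin n) ℤ) r.num).map (Int.castRingHom ℚ) =
        (r.num : ℚ) • (1 : Matrix (Fin n) (Fin n) ℚ) := by
      ext i j
      simp only [Matrix.map_apply, Matrix.algebraMap_matrix_apply, Matrix.smul_apply, Matrix.one_apply]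
      split_ifs <;> simp
    rw [h1, map_smul, Matrix.toLin'_one, Algebra.algebraMap_eq_smul_one, smul_smul,
      Rat.den_mul_eq_num]
    rfl
  | add f g _ _ hf hg =>
    obtain ⟨N, hN, x, hx, h1⟩ := hf
    obtain ⟨M, hM, y, hy, h2⟩ := hg
    refine ⟨N * M, mul_ne_zero hN hM, M • x + N • y,
      Subalgebra.add_mem _ (Subalgebra.nsmul_mem _ hx _) (Subalgebra.nsmul_mem _ hy _), ?_⟩
    have h3 : (M • x + N • y).map (Int.castRingHom ℚ) =
      (M : ℚ) • x.map (Int.castRingHom ℚ) + (N : ℚ) • y.map (Int.castRingHom ℚ) := by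
      ext i j
      simp only [Matrix.map_apply, Matrix.add_apply, Matrix.smul_apply, map_add, map_nsmul]
      simp only [nsmul_eq_mul, smul_eq_mul]
    rw [h3, map_add, map_smul, map_smul, ← h1, ← h2, smul_smul, smul_smul, smul_add]
    push_cast
    rw [mul_comm (M : ℚ)]
  | mul f g _ _ hf hg =>
    obtain ⟨N, hN, x, hx, h1⟩ := hf
    obtain ⟨M, hM, y, hy, h2⟩ := hg
    refine ⟨N * M, mul_ne_zero hN hM, x * y, Subalgebra.mul_mem _ hx hy, ?_⟩
    rw [Matrix.map_mul, Matrix.toLin'_mul, ← h1, ← h2]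
    push_cast
    change _ = ((N : ℚ) • f) * ((M : ℚ) • g)
    rw [smul_mul_smul_comm]

theorem irred_mod {n : ℕ} (H : Subgroup (SL n ℤ))
    (habs : Algebra.adjoin ℚ (rhoQ n '' (H : Set (SL n ℤ))) = ⊤) :
    ∃ N : ℕ, N ≠ 0 ∧ ∀ p : ℕ, p.Prime → ¬ p ∣ N →
      IrreducibleSub (ZMod p) (H.map (redMod n p)) := by
  have key : ∀ ij : Fin n × Fin n, ∃ N : ℕ, N ≠ 0 ∧ (N : ℤ) • Matrix.single ij.1 ij.2 (1 : ℤ) ∈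
      Algebra.adjoin ℤ
        ((fun g : SL n ℤ => (g : Matrix (Fin n) (Fin n) ℤ)) '' (H : Set (SL n ℤ))) := by
    rintro ⟨i, j⟩
    obtain ⟨N, hN, x, hx, h⟩ := exists_int_multiple H
      (Matrix.toLin' (Matrix.single i j (1 : ℚ))) (by rw [habs]; trivial)
    refine ⟨N, hN, ?_⟩
    rw [← map_smul] at h
    have h1 := Matrix.toLin'.injective h
    have h2 : x = (N : ℤ) • Matrix.single i j (1 : ℤ) := by
      ext a b
      have := congrFun (congrFun h1 a) b
      simp only [Matrix.smul_apply, Matrix.map_apply, Matrix.single_apply, smul_eq_mul,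
        eq_intCast] at this ⊢
      have h3 : ((x a b : ℤ) : ℚ) = (((N : ℤ) * (if i = a ∧ j = b then 1 else 0) : ℤ) : ℚ) := by
        rw [← this]; push_cast; rfl
      exact_mod_cast h3
    rw [← h2]; exact hx
  choose N hN hmem using key
  refine ⟨∏ ij, N ij, Finset.prod_ne_zero_iff.2 fun ij _ => hN ij, ?_⟩
  intro p hp hdvd W hW
  haveI : Fact p.Prime := ⟨hp⟩
  have hinv : ∀ x ∈ Algebra.adjoin ℤ
      ((fun g : SL n ℤ => (g : Matrix (Fin n) (Fin n) ℤ)) '' (H : Set (SL n ℤ))),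
      ∀ w ∈ W, (x.map (Int.castRingHom (ZMod p))) *ᵥ w ∈ W := by
    intro x hx
    induction hx using Algebra.adjoin_induction with
    | mem x hx =>
      obtain ⟨g, hg, rfl⟩ := hx
      intro w hw
      exact hW (redMod n p g) ⟨g, hg, rfl⟩ ⟨w, hw, by rw [Matrix.toLin'_apply]; rfl⟩
    | algebraMap r =>
      intro w hw
      have h1 : (algebraMap ℤ (Matrix (Fin n) (Fin n) ℤ) r).map (Int.castRingHom (ZMod p)) =
          (r : ZMod p) • (1 : Matrix (Fin n) (Fin n) (ZMod p)) := by
        ext i j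
        simp only [Matrix.map_apply, Matrix.algebraMap_matrix_apply, Matrix.smul_apply, Matrix.one_apply]
        split_ifs <;> simp
      rw [h1, Matrix.smul_mulVec, Matrix.one_mulVec]
      exact W.smul_mem _ hw
    | add x y _ _ hx hy =>
      intro w hw
      rw [Matrix.map_add _ (map_add _), Matrix.add_mulVec]
      exact W.add_mem (hx w hw) (hy w hw)
    | mul x y _ _ hx hy =>
      intro w hw
      rw [Matrix.map_mul, ← Matrix.mulVec_mulVec]
      exact hx _ (hy w hw)
  by_cases hbot : W = ⊥
  · exact Or.inl hbot
  right
  obtain ⟨w, hw, hw0⟩ := W.ne_bot_iff.1 hbot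
  obtain ⟨j, hj⟩ := Function.ne_iff.1 hw0
  have hsingle : ∀ i, (Pi.single i 1 : Fin n → ZMod p) ∈ W := by
    intro i
    have h1 := hinv _ (hmem (i, j)) w hw
    have hne : ((N (i, j) : ℕ) : ZMod p) ≠ 0 := by
      intro h0
      rw [ZMod.natCast_eq_zero_iff] at h0
      exact hdvd (h0.trans (Finset.dvd_prod_of_mem _ (Finset.mem_univ _)))
    have h2 : (((N (i, j) : ℤ) • Matrix.single i j (1 : ℤ)).map (Int.castRingHom (ZMod p))) *ᵥ w =
        (((N (i, j) : ℕ) : ZMod p) * w j) • (Pi.single i 1 : Fin n → ZMod p) := by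
      have h3 : ((N (i, j) : ℤ) • Matrix.single i j (1 : ℤ)).map (Int.castRingHom (ZMod p)) =
          ((N (i, j) : ℕ) : ZMod p) • Matrix.single i j (1 : ZMod p) := by
        ext a b
        simp only [Matrix.smul_apply, Matrix.map_apply, Matrix.single_apply, smul_eq_mul]
        split_ifs <;> simp
      rw [h3, Matrix.smul_mulVec, Matrix.single_mulVec, mul_smul]
      congr 1
      ext a
      simp [Function.update_apply, Pi.single_apply]
    rw [h2] at h1
    exact (W.smul_mem_iff (mul_ne_zero hne hj)).1 h1
  rw [eq_top_iff]
  intro v _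
  rw [pi_eq_sum_univ' v]
  refine W.sum_mem fun i _ => W.smul_mem _ ?_
  convert hsingle i using 1

theorem monomial_hom_s4 {n : ℕ} (hn : n.Prime) {F : Type} [Field F] (G : Subgroup (SL n F))
    (hirr : IrreducibleSub F G) (himp : ImprimitiveSub F G) :
    ∃ α : G →* Equiv.Perm (Fin n), ∀ a ∈ α.ker, ∀ b ∈ α.ker, a * b = b * a := by
  obtain ⟨m, hm, W, hne, hint, hperm⟩ := himp
  have hind := hint.submodule_iSupIndep
  have hsup := hint.submodule_iSup_eq_top
  have hinj : Function.Injective W := hind.injective hne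
  have hperm' : ∀ (g : G) i, ∃ j, (W i).map (Matrix.toLin' g.1.1) = W j :=
    fun g i => hperm g.1 g.2 i
  choose τ hτ using hperm'
  have hmulL : ∀ a b : G, Matrix.toLin' (a * b).1.1 = Matrix.toLin' a.1.1 ∘ₗ Matrix.toLin' b.1.1 := by
    intro a b
    rw [← Matrix.toLin'_mul]; rfl
  have hinjL : ∀ g : G, Function.Injective (Matrix.toLin' g.1.1) := by
    intro g
    have : Matrix.toLin' (g⁻¹).1.1 ∘ₗ Matrix.toLin' g.1.1 = LinearMap.id := by
      rw [← hmulL, inv_mul_cancel]; exact Matrix.toLin'_one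
    exact Function.LeftInverse.injective (g := Matrix.toLin' (g⁻¹).1.1)
      (fun v => LinearMap.congr_fun this v)
  have hτ1 : ∀ i, τ 1 i = i := by
    intro i
    apply hinj
    rw [← hτ]
    change (W i).map (Matrix.toLin' 1) = _
    rw [Matrix.toLin'_one, Submodule.map_id]
  have hτmul : ∀ a b i, τ (a * b) i = τ a (τ b i) := by
    intro a b i
    apply hinj
    rw [← hτ, ← hτ, ← hτ, hmulL, Submodule.map_comp]
  have hrk : ∀ (g : G) i, Module.finrank F (W (τ g i)) = Module.finrank F (W i) := by
    intro g i
    rw [← hτ]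
    exact (LinearEquiv.finrank_eq (Submodule.equivMapOfInjective _ (hinjL g) (W i))).symm
  let i0 : Fin m := ⟨0, by omega⟩
  let d := Module.finrank F (W i0)
  have hall : ∀ i, Module.finrank F (W i) = d := by
    let U : Submodule F (Fin n → F) := ⨆ i : {i // Module.finrank F (W i) = d}, W i.1
    have hU : U = ⊥ ∨ U = ⊤ := by
      refine hirr U fun g hg => ?_
      rw [Submodule.map_iSup]
      refine iSup_le fun i => ?_
      have h1 := hτ ⟨g, hg⟩ i.1
      rw [h1]
      exact le_iSup (fun i : {i // Module.finrank F (W i) = d} => W i.1)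
        ⟨τ ⟨g, hg⟩ i.1, (hrk _ _).trans i.2⟩
    have hle : W i0 ≤ U := le_iSup (fun i : {i // Module.finrank F (W i) = d} => W i.1) ⟨i0, rfl⟩
    have hUt : U = ⊤ := hU.resolve_left fun h => hne i0 (by rw [h] at hle; exact le_bot_iff.1 hle)
    intro i
    by_contra hi
    have h2 := hind i
    have h3 : U ≤ ⨆ j, ⨆ (_ : j ≠ i), W j := by
      refine iSup_le fun j => ?_
      exact le_iSup₂_of_le j.1 (fun h => hi (h ▸ j.2)) le_rfl
    rw [hUt, top_le_iff] at h3
    rw [h3, disjoint_top] at h2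
    exact hne i h2
  have hcard : n = m * d := by
    have h1 := LinearEquiv.finrank_eq (LinearEquiv.ofBijective (DirectSum.coeLinearMap W) hint)
    rw [Module.finrank_fin_fun, Module.finrank_directSum] at h1
    rw [← h1, Finset.sum_congr rfl fun i _ => hall i]
    simp
  have hmn : m = n := by
    rcases (Nat.dvd_prime hn).1 ⟨d, hcard⟩ with h | h
    · omega
    · exact h
  have hd : d = 1 := by
    rw [hmn] at hcard
    have := hn.pos
    nlinarith
  subst hmn
  letI : MulAction G (Fin m) :=
    { smul := τ
      one_smul := hτ1
      mul_smul := hτmul }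
  refine ⟨MulAction.toPermHom G (Fin m), ?_⟩
  have hscal : ∀ a ∈ (MulAction.toPermHom G (Fin m)).ker, ∀ i, ∃ c : F, ∀ w ∈ W i,
      Matrix.toLin' a.1.1 w = c • w := by
    intro a ha i
    have h1 : τ a i = i := by
      have := congrArg (fun e : Equiv.Perm (Fin m) => e i) (MonoidHom.mem_ker.1 ha)
      exact this
    have h2 := hτ a i
    rw [h1] at h2
    obtain ⟨v, hv, hspan⟩ := finrank_eq_one_iff'.1 ((hall i).trans hd)
    have h3 : Matrix.toLin' a.1.1 v.1 ∈ W i := by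
      have : Matrix.toLin' a.1.1 v.1 ∈ (W i).map (Matrix.toLin' a.1.1) := ⟨v.1, v.2, rfl⟩
      rwa [h2] at this
    obtain ⟨c, hc⟩ := hspan ⟨_, h3⟩
    have hc' : c • v.1 = Matrix.toLin' a.1.1 v.1 := congrArg Subtype.val hc
    refine ⟨c, fun w hw => ?_⟩
    obtain ⟨b, hb⟩ := hspan ⟨w, hw⟩
    have hb' : b • v.1 = w := congrArg Subtype.val hb
    rw [← hb', map_smul, ← hc', smul_smul, smul_smul, mul_comm]
  intro a ha b hb
  apply Subtype.ext
  apply Subtype.ext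
  apply Matrix.toLin'.injective
  rw [hmulL a b, hmulL b a]
  rw [← sub_eq_zero, ← LinearMap.ker_eq_top, eq_top_iff, ← hsup]
  refine iSup_le fun i w hw => ?_
  obtain ⟨c, hc⟩ := hscal a ha i
  obtain ⟨c', hc'⟩ := hscal b hb i
  rw [LinearMap.mem_ker, LinearMap.sub_apply, LinearMap.comp_apply, LinearMap.comp_apply,
    hc' w hw, hc w hw, map_smul, map_smul, hc w hw, hc' w hw, smul_smul, smul_smul, mul_comm, sub_self]

theorem finite_hom {G P : Type*} [Group G] [Group P] [Finite P] (hG : Group.FG G) :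
    Finite (G →* P) := by
  obtain ⟨S, hS⟩ := hG.out
  refine Finite.of_injective (fun (f : G →* P) (s : S) => f s.1) ?_
  intro f g hfg
  exact MonoidHom.eq_of_eqOn_dense hS fun s hs => congrFun hfg ⟨s, hs⟩

/-- For prime `n`, if `H ≤ SL(n,ℤ)` is finitely generated, infinite,
non-solvable, and primitive, then `φ_p(H)` is primitive for all but finitely many primes. -/
theorem primitive_mod_p_cofinitely (n : ℕ) (hn : n.Prime)
    (H : Subgroup (SL n ℤ)) (hFG : H.FG) (hinf : Infinite H)
    (hns : ¬ IsSolvable H) (hprim : PrimitiveQ H) :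
    {p : ℕ | p.Prime ∧ ¬ PrimitiveSub (ZMod p) (H.map (redMod n p))}.Finite := by
  have hnc : ∃ a ∈ H, ∃ b ∈ H, a * b ≠ b * a := by
    by_contra! hcon
    exact hns (Group.isSolvable_of_comm fun a b => Subtype.ext (hcon a.1 a.2 b.1 b.2))
  obtain ⟨N, hN, hirr⟩ := irred_mod H (absIrred hn H hprim.1 hnc)
  haveI : Finite (H →* Equiv.Perm (Fin n)) := finite_hom ((Group.fg_iff_subgroup_fg H).2 hFG)
  let S : (H →* Equiv.Perm (Fin n)) → Set ℕ := fun α =>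
    {p | ∀ a ∈ α.ker, ∀ b ∈ α.ker, redMod n p (a * b : H) = redMod n p (b * a : H)}
  have hSfin : ∀ α, (S α).Finite := by
    intro α
    by_contra hinfS
    haveI : α.ker.FiniteIndex := inferInstance
    exact no_abelian hn H hinf hns hprim α.ker fun a ha b hb =>
      Subtype.ext (eq_of_redMod_eq hinfS _ _ fun p hp => hp a ha b hb)
  refine ((Set.finite_Iic N).union (Set.finite_iUnion hSfin)).subset ?_
  rintro p ⟨hp, hnp⟩
  by_cases hdvd : p ∣ N
  · exact Or.inl (Nat.le_of_dvd (Nat.pos_of_ne_zero hN) hdvd)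
  right
  haveI : Fact p.Prime := ⟨hp⟩
  have hi := hirr p hp hdvd
  have himp : ImprimitiveSub (ZMod p) (H.map (redMod n p)) := by
    by_contra h
    exact hnp ⟨hi, h⟩
  obtain ⟨β, hβ⟩ := monomial_hom_s4 hn _ hi himp
  rw [Set.mem_iUnion]
  refine ⟨β.comp ((redMod n p).subgroupMap H), fun a ha b hb => ?_⟩
  have h1 := hβ ((redMod n p).subgroupMap H a) ha ((redMod n p).subgroupMap H b) hb
  have h2 := congrArg Subtype.val h1
  simpa using h2
end

section
/- Let H be a finitely generated subgroup of SL(n,ℤ) that is not solvable. Then for all but finitely many primes p, the image φ_p(H) is not a solvable group. -/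
open Matrix

namespace ZL

theorem derived_finite {Q : Type*} [Group Q] [Finite Q] [Group.IsSolvable Q] :
    derivedSeries Q (Nat.card Q) = ⊥ := by
  have key : ∀ k, derivedSeries Q k = ⊥ ∨ Nat.card (derivedSeries Q k) + k ≤ Nat.card Q := by
    intro k
    induction k with
    | zero => right; simp
    | succ k ih =>
      by_cases h : derivedSeries Q k = ⊥
      · left
        exact le_bot_iff.1 (h ▸ derivedSeries_antitone _ (Nat.le_succ k))
      · right
        have h1 := ih.resolve_left h
        have h2 : derivedSeries Q (k + 1) < derivedSeries Q k := by
          rw [derivedSeries_succ]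
          exact Group.IsSolvable.commutator_lt_of_ne_bot h
        have h3 : Nat.card (derivedSeries Q (k + 1)) < Nat.card (derivedSeries Q k) := by
          refine lt_of_le_of_ne (Subgroup.card_le_of_le h2.le) ?_
          intro he
          exact h2.ne (Subgroup.eq_of_le_of_card_ge h2.le he.ge)
        omega
  rcases key (Nat.card Q) with h | h
  · exact h
  · have : 0 < Nat.card (derivedSeries Q (Nat.card Q)) := Nat.card_pos
    omega

theorem derived_perm {P X : Type*} [Group P] [Group.IsSolvable P] [Finite X] (f : P →* Equiv.Perm X)
    (k : ℕ) (hk : (Nat.card X).factorial ≤ k) (m : P) (hm : m ∈ derivedSeries P k) : f m = 1 := by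
  have hs : Group.IsSolvable f.range := Group.isSolvable_of_surjective f.rangeRestrict_surjective
  have h1 : Nat.card f.range ≤ k := by
    refine le_trans ?_ hk
    rw [← Nat.card_perm]
    exact Subgroup.card_le_card_group _
  have h2 : f.rangeRestrict m ∈ derivedSeries f.range (Nat.card f.range) :=
    derivedSeries_antitone _ h1
      (map_derivedSeries_le_derivedSeries f.rangeRestrict k (Subgroup.mem_map_of_mem _ hm))
  rw [derived_finite, Subgroup.mem_bot] at h2
  simpa using congrArg Subtype.val h2

variable {F G V : Type*} [Field F] [Group G] [AddCommGroup V] [Module F V]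

/-- joint eigenvector of a subgroup -/
def JE (ρ : Representation F G V) (B : Subgroup G) (v : V) : Prop :=
  ∀ b ∈ B, ∃ c : F, ρ b v = c • v

/-- weights of a subgroup -/
def Wt (ρ : Representation F G V) (B : Subgroup G) : Type _ :=
  {χ : B →* F // ∃ v : V, v ≠ 0 ∧ ∀ b : B, ρ b v = χ b • v}

theorem wt_card (ρ : Representation F G V) (B : Subgroup G) [FiniteDimensional F V] :
    Finite (Wt ρ B) ∧ Nat.card (Wt ρ B) ≤ Module.finrank F V := by
  choose v hv0 hv using fun χ : Wt ρ B => χ.2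
  have hli : LinearIndependent F v := by
    rw [linearIndependent_iff']
    intro s c hc i hi
    obtain ⟨φ, hφ⟩ := not_forall.1
      (mt (Module.forall_dual_apply_eq_zero_iff F (v i)).1 (hv0 i))
    have hd := (linearIndependent_monoidHom B F).comp (fun χ : Wt ρ B => χ.1)
      Subtype.val_injective
    rw [linearIndependent_iff'] at hd
    have := hd s (fun j => c j * φ (v j)) ?_ i hi
    · rcases mul_eq_zero.1 this with h | h
      · exact h
      · exact absurd h hφ
    · funext b
      have h := congrArg (fun x => φ (ρ b x)) hc
      simp only [map_sum, map_smul, hv, smul_eq_mul, map_zero] at h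
      simp only [Finset.sum_apply, Pi.smul_apply, smul_eq_mul, Pi.zero_apply, Function.comp]
      rw [← h]
      refine Finset.sum_congr rfl fun j _ => ?_
      ring
  have hf : Finite (Wt ρ B) := hli.finite
  refine ⟨hf, ?_⟩
  have := Fintype.ofFinite (Wt ρ B)
  rw [Nat.card_eq_fintype_card]
  exact hli.fintype_card_le_finrank

/-- translate of a weight -/
def wtAct (ρ : Representation F G V) (B : Subgroup G) [B.Normal] (g : G) (χ : Wt ρ B) :
    Wt ρ B :=
  ⟨χ.1.comp (MulAut.conjNormal g⁻¹ : MulAut B).toMonoidHom, by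
    obtain ⟨v, hv0, hv⟩ := χ.2
    refine ⟨ρ g v, ?_, ?_⟩
    · intro h
      apply hv0
      have := congrArg (ρ g⁻¹) h
      rwa [← Module.End.mul_apply, ← map_mul, inv_mul_cancel, map_one, map_zero] at this
    · intro b
      have := congrArg (ρ g) (hv (MulAut.conjNormal g⁻¹ b))
      rw [← Module.End.mul_apply, ← map_mul, map_smul] at this
      simp only [MulAut.conjNormal_apply, inv_inv] at this
      rw [← mul_assoc, ← mul_assoc, mul_inv_cancel, one_mul, map_mul] at this
      exact this⟩

/-- permutation action on weights -/
def wtHom (ρ : Representation F G V) (B : Subgroup G) [B.Normal] :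
    G →* Equiv.Perm (Wt ρ B) :=
  letI : MulAction G (Wt ρ B) :=
    { smul := wtAct ρ B
      one_smul := fun χ => Subtype.ext (by
        ext b
        change χ.1 (MulAut.conjNormal (1 : G)⁻¹ b) = χ.1 b
        simp)
      mul_smul := fun g h χ => Subtype.ext (by
        ext b
        change χ.1 (MulAut.conjNormal (g * h)⁻¹ b)
          = χ.1 (MulAut.conjNormal h⁻¹ (MulAut.conjNormal g⁻¹ b))
        rw [_root_.mul_inv_rev, map_mul, MulAut.mul_apply]) }
  MulAction.toPermHom G (Wt ρ B)

theorem wtHom_apply (ρ : Representation F G V) (B : Subgroup G) [B.Normal] (g : G)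
    (χ : Wt ρ B) (b : B) : (wtHom ρ B g χ).1 b = χ.1 (MulAut.conjNormal g⁻¹ b) := rfl

theorem JE_fixed [Group.IsSolvable G] [FiniteDimensional F V] (ρ : Representation F G V)
    (B : Subgroup G) [B.Normal] (k : ℕ) (hk : (Module.finrank F V).factorial ≤ k)
    (m : G) (hm : m ∈ derivedSeries G k) (v : V) (hv : JE ρ B v) (b : G) (hb : b ∈ B) :
    ρ (m * b * m⁻¹) v = ρ b v := by
  by_cases h0 : v = 0
  · simp [h0]
  choose c hc using hv
  have hmul : ∀ x y : B, c (x * y) (x * y).2 = c x x.2 * c y y.2 := by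
    intro x y
    have h1 := hc (x * y) (x * y).2
    rw [map_mul, Module.End.mul_apply, hc y y.2, map_smul, hc x x.2, smul_smul] at h1
    have := smul_left_injective F h0 h1
    rw [← this, mul_comm]
  have hone : c (1 : B) (1 : B).2 = 1 := by
    have h1 := hc (1 : B) (1 : B).2
    have h2 : (1 : F) • v = c (1 : B) (1 : B).2 • v := by
      rw [← h1]; simp
    exact (smul_left_injective F h0 h2).symm
  let χ : Wt ρ B := ⟨{ toFun := fun b => c b b.2, map_one' := hone, map_mul' := hmul },
    v, h0, fun b => hc b b.2⟩
  obtain ⟨hf, hcard⟩ := wt_card ρ B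
  have hfix := derived_perm (wtHom ρ B) k ((Nat.factorial_le hcard).trans hk) m⁻¹ (inv_mem hm)
  have h1 := wtHom_apply ρ B m⁻¹ χ ⟨b, hb⟩
  rw [hfix] at h1
  have hmem : m * b * m⁻¹ ∈ B := Subgroup.Normal.conj_mem inferInstance b hb m
  have h2 : MulAut.conjNormal (m⁻¹)⁻¹ (⟨b, hb⟩ : B) = ⟨m * b * m⁻¹, hmem⟩ := by
    ext; simp
  rw [h2] at h1
  have h3 : c b hb = c _ hmem := h1
  rw [hc _ hmem, hc b hb, h3]

open scoped commutatorElement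

/-- invariant submodules are trivial -/
def Irr (ρ : Representation F G V) : Prop :=
  ∀ W : Submodule F V, (∀ g : G, ∀ w ∈ W, ρ g w ∈ W) → W = ⊥ ∨ W = ⊤

theorem exists_JE [IsAlgClosed F] [FiniteDimensional F V] [Nontrivial V]
    (ρ : Representation F G V) (A : Subgroup G)
    (hA : ∀ a ∈ A, ∀ b ∈ A, a * b = b * a) : ∃ v, v ≠ 0 ∧ JE ρ A v := by
  let S : Set (Submodule F V) := {W | W ≠ ⊥ ∧ ∀ a ∈ A, ∀ w ∈ W, ρ a w ∈ W}
  have hS : S.Nonempty := ⟨⊤, top_ne_bot, fun _ _ _ _ => trivial⟩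
  obtain ⟨W, ⟨hW0, hWA⟩, hmin⟩ := WellFounded.has_min (wellFounded_lt (α := Submodule F V)) S hS
  obtain ⟨v, hvW, hv0⟩ := Submodule.exists_mem_ne_zero_of_ne_bot hW0
  refine ⟨v, hv0, fun a ha => ?_⟩
  have : Nontrivial W := Submodule.nontrivial_iff_ne_bot.2 hW0
  obtain ⟨c, hc⟩ := Module.End.exists_eigenvalue ((ρ a).restrict (hWA a ha))
  obtain ⟨w, hw⟩ := hc.exists_hasEigenvector
  have hw1 : ρ a w = c • (w : V) := congrArg Subtype.val hw.apply_eq_smul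
  let U : Submodule F V := W ⊓ Module.End.eigenspace (ρ a) c
  have hU : U ∈ S := by
    refine ⟨?_, ?_⟩
    · rw [Submodule.ne_bot_iff]
      refine ⟨w, ⟨w.2, Module.End.mem_eigenspace_iff.2 hw1⟩, ?_⟩
      simpa using hw.2
    · rintro b hb x ⟨hx1, hx2⟩
      refine ⟨hWA b hb x hx1, ?_⟩
      rw [SetLike.mem_coe, Module.End.mem_eigenspace_iff] at hx2 ⊢
      rw [← Module.End.mul_apply, ← map_mul, hA a ha b hb, map_mul, Module.End.mul_apply, hx2,
        map_smul]
  have hUW : U = W := by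
    by_contra hne
    exact hmin U hU (lt_of_le_of_ne inf_le_left hne)
  have : v ∈ U := hUW ▸ hvW
  exact ⟨c, Module.End.mem_eigenspace_iff.1 this.2⟩

theorem JE_smul (ρ : Representation F G V) (A : Subgroup G) [A.Normal] (g : G) (v : V)
    (hv : JE ρ A v) : JE ρ A (ρ g v) := by
  intro a ha
  obtain ⟨c, hc⟩ := hv (g⁻¹ * a * g) (by
    simpa using Subgroup.Normal.conj_mem (inferInstance : A.Normal) a ha g⁻¹)
  refine ⟨c, ?_⟩
  rw [← map_smul, ← hc, ← Module.End.mul_apply, ← Module.End.mul_apply, ← map_mul, ← map_mul]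
  congr 2
  group

theorem span_JE [IsAlgClosed F] [FiniteDimensional F V] [Nontrivial V]
    (ρ : Representation F G V) (hρ : Irr ρ) (A : Subgroup G) [A.Normal]
    (hA : ∀ a ∈ A, ∀ b ∈ A, a * b = b * a) : Submodule.span F {v | JE ρ A v} = ⊤ := by
  refine (hρ _ ?_).resolve_left ?_
  · intro g w hw
    have : Submodule.span F {v | JE ρ A v} ≤ (Submodule.span F {v | JE ρ A v}).comap (ρ g) := by
      rw [Submodule.span_le]
      intro v hv
      exact Submodule.subset_span (JE_smul ρ A g v hv)
    exact this hw
  · obtain ⟨v, hv0, hv⟩ := exists_JE ρ A hA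
    intro h
    apply hv0
    rw [← Submodule.mem_bot F, ← h]
    exact Submodule.subset_span hv

theorem eq_of_span {A : Subgroup G} {ρ : Representation F G V}
    (hs : Submodule.span F {v | JE ρ A v} = ⊤) (f g : V →ₗ[F] V)
    (h : ∀ v, JE ρ A v → f v = g v) : f = g :=
  LinearMap.ext_on hs h

/-- the joint eigenspace -/
def jes (ρ : Representation F G V) (A : Subgroup G) (χ : A → F) : Submodule F V :=
  ⨅ a : A, Module.End.eigenspace (ρ a) (χ a)

theorem mem_jes {ρ : Representation F G V} {A : Subgroup G} {χ : A → F} {v : V} :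
    v ∈ jes ρ A χ ↔ ∀ a : A, ρ a v = χ a • v := by
  simp [jes, Submodule.mem_iInf]

theorem jes_indep (ρ : Representation F G V) (A : Subgroup G)
    (hA : ∀ a ∈ A, ∀ b ∈ A, a * b = b * a) : iSupIndep (jes ρ A) := by
  refine (Module.End.independent_iInf_maxGenEigenspace_of_forall_mapsTo
    (fun a : A => ρ a) ?_).mono ?_
  · intro i j φ
    apply Module.End.mapsTo_maxGenEigenspace_of_comm
    change ρ j * ρ i = ρ i * ρ j
    rw [← map_mul, ← map_mul, hA j j.2 i i.2]
  · intro χ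
    refine iInf_mono fun a => ?_
    exact (Module.End.genEigenspace (ρ a) (χ a)).mono le_top

theorem exists_proj (ρ : Representation F G V) (A B : Subgroup G)
    (hA : ∀ a ∈ A, ∀ b ∈ A, a * b = b * a)
    (hAB : ∀ a ∈ A, ∀ b ∈ B, a * b = b * a)
    (hs : Submodule.span F {v | JE ρ A v} = ⊤) (v : V) (hv : JE ρ A v) :
    ∃ e : V →ₗ[F] V, e v = v ∧ (∀ b ∈ B, ρ b ∘ₗ e = e ∘ₗ ρ b) ∧
      ∀ a ∈ A, ∃ c : F, ρ a ∘ₗ e = c • e := by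
  choose c hc using hv
  let χ : A → F := fun a => c a a.2
  have hinv : ∀ ψ : A → F, ∀ b ∈ B, ∀ w ∈ jes ρ A ψ, ρ b w ∈ jes ρ A ψ := by
    intro ψ b hb w hw
    rw [mem_jes] at hw ⊢
    intro a
    rw [← Module.End.mul_apply, ← map_mul, hAB a a.2 b hb, map_mul, Module.End.mul_apply, hw,
      map_smul]
  let U : Submodule F V := ⨆ ψ : A → F, ⨆ (_ : ψ ≠ χ), jes ρ A ψ
  have hUinv : ∀ b ∈ B, ∀ w ∈ U, ρ b w ∈ U := by
    intro b hb w hw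
    have : U ≤ U.comap (ρ b) := by
      refine iSup₂_le fun ψ hψ x hx => ?_
      exact (le_iSup₂_of_le (f := fun (ψ : A → F) (_ : ψ ≠ χ) => jes ρ A ψ) ψ hψ le_rfl)
        (hinv ψ b hb x hx)
    exact this hw
  have hcompl : IsCompl (jes ρ A χ) U := by
    refine ⟨jes_indep ρ A hA χ, ?_⟩
    rw [codisjoint_iff, ← top_le_iff, ← hs, Submodule.span_le]
    intro w hw
    choose d hd using hw
    let ψ : A → F := fun a => d a a.2
    have hwψ : w ∈ jes ρ A ψ := mem_jes.2 fun a => hd a a.2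
    by_cases h : ψ = χ
    · exact (le_sup_left : jes ρ A χ ≤ _) (h ▸ hwψ)
    · exact (le_sup_right : U ≤ _)
        ((le_iSup₂_of_le (f := fun (ψ : A → F) (_ : ψ ≠ χ) => jes ρ A ψ) ψ h le_rfl) hwψ)
  have hvχ : v ∈ jes ρ A χ := mem_jes.2 fun a => hc a a.2
  refine ⟨(jes ρ A χ).projection U hcompl, Submodule.projection_apply_of_mem_left hcompl hvχ,
    ?_, ?_⟩
  · intro b hb
    ext x
    have hx : x ∈ jes ρ A χ ⊔ U := by rw [hcompl.sup_eq_top]; trivial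
    obtain ⟨w, hw, u, hu, rfl⟩ := Submodule.mem_sup.1 hx
    simp only [LinearMap.comp_apply, map_add]
    rw [Submodule.projection_apply_of_mem_left hcompl hw,
      Submodule.projection_apply_of_mem_left hcompl (hinv χ b hb w hw),
      Submodule.projection_apply_of_mem_right hcompl hu,
      Submodule.projection_apply_of_mem_right hcompl (hUinv b hb u hu), map_zero]
  · intro a ha
    refine ⟨χ ⟨a, ha⟩, ?_⟩
    ext x
    exact mem_jes.1 (Submodule.projection_apply_mem hcompl x) ⟨a, ha⟩

/-- centralizing of abelian normal subgroups -/
theorem central_abelian [IsAlgClosed F] [Group.IsSolvable G] [FiniteDimensional F V] [Nontrivial V]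
    (ρ : Representation F G V) (hinj : Function.Injective ρ) (hρ : Irr ρ)
    (k : ℕ) (hk : (Module.finrank F V).factorial ≤ k) (A : Subgroup G) [A.Normal]
    (hA : ∀ a ∈ A, ∀ b ∈ A, a * b = b * a) (m : G) (hm : m ∈ derivedSeries G k)
    (a : G) (ha : a ∈ A) : m * a * m⁻¹ = a :=
  hinj (eq_of_span (span_JE ρ hρ A hA) _ _ fun v hv => JE_fixed ρ A k hk m hm v hv a ha)

theorem central_class_two [IsAlgClosed F] [Group.IsSolvable G] [FiniteDimensional F V]
    [Nontrivial V] (ρ : Representation F G V) (hinj : Function.Injective ρ) (hρ : Irr ρ)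
    (k : ℕ) (hk : (Module.finrank F V ^ 2).factorial ≤ k) (B : Subgroup G) [B.Normal]
    (hB : (⁅B, B⁆ : Subgroup G) ≤ Subgroup.centralizer (B : Set G)) (m : G) (hm : m ∈ derivedSeries G k)
    (b : G) (hb : b ∈ B) : ⁅m, b⁆ ∈ Subgroup.centralizer (B : Set G) := by
  let A : Subgroup G := B ⊓ Subgroup.centralizer (B : Set G)
  have hA : ∀ a ∈ A, ∀ b ∈ A, a * b = b * a := by
    rintro a ⟨_, ha⟩ b ⟨hb, _⟩
    exact (Subgroup.mem_centralizer_iff.1 ha b hb).symm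
  have hAB : ∀ a ∈ A, ∀ b ∈ B, a * b = b * a := by
    rintro a ⟨_, ha⟩ b hb
    exact (Subgroup.mem_centralizer_iff.1 ha b hb).symm
  have hs := span_JE ρ hρ A hA
  have hb1 : m * b * m⁻¹ ∈ B := Subgroup.Normal.conj_mem inferInstance b hb m
  have key : ∀ b' ∈ B, m * b * m⁻¹ * b' * (m * b * m⁻¹)⁻¹ = b * b' * b⁻¹ := by
    intro b' hb'
    apply hinj
    apply eq_of_span hs
    intro v hv
    obtain ⟨e, hev, heB, heA⟩ := exists_proj ρ A B hA hAB hs v hv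
    have hconj : ∀ x ∈ B, (Representation.linHom ρ ρ) x (ρ b' ∘ₗ e) = ρ (x * b' * x⁻¹) ∘ₗ e := by
      intro x hx
      rw [Representation.linHom_apply, LinearMap.comp_assoc, ← heB _ (inv_mem hx), map_mul,
        map_mul]
      rfl
    have hJE : JE (Representation.linHom ρ ρ) B (ρ b' ∘ₗ e) := by
      intro x hx
      have hcomm : ⁅b'⁻¹, x⁆ ∈ A :=
        ⟨Subgroup.commutator_le_left B B (Subgroup.commutator_mem_commutator (inv_mem hb') hx),
          hB (Subgroup.commutator_mem_commutator (inv_mem hb') hx)⟩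
      obtain ⟨c, hc⟩ := heA _ hcomm
      refine ⟨c, ?_⟩
      rw [hconj x hx]
      have : x * b' * x⁻¹ = b' * ⁅b'⁻¹, x⁆ := by
        rw [commutatorElement_def]; group
      rw [this, map_mul, ← LinearMap.comp_smul, ← hc]
      rfl
    have hfix := JE_fixed (Representation.linHom ρ ρ) B k
      (by rwa [Module.finrank_linearMap, ← sq]) m hm _ hJE b hb
    rw [hconj _ hb1, hconj _ hb] at hfix
    have := congrArg (fun f : V →ₗ[F] V => f v) hfix
    simpa [hev] using this
  rw [Subgroup.mem_centralizer_iff]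
  intro h hh
  have := key (b⁻¹ * h * b) (mul_mem (mul_mem (inv_mem hb) hh) hb)
  rw [commutatorElement_def]
  have e1 : b * (b⁻¹ * h * b) * b⁻¹ = h := by group
  rw [e1] at this
  calc h * (m * b * m⁻¹ * b⁻¹)
      = (m * b * m⁻¹ * (b⁻¹ * h * b) * (m * b * m⁻¹)⁻¹) * (m * b * m⁻¹ * b⁻¹) := by rw [this]
    _ = m * b * m⁻¹ * b⁻¹ * h := by group

theorem lemmaC [IsAlgClosed F] [Group.IsSolvable G] [FiniteDimensional F V]
    [Nontrivial V] (ρ : Representation F G V) (hinj : Function.Injective ρ) (hρ : Irr ρ)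
    (k : ℕ) (hk : (Module.finrank F V ^ 2).factorial ≤ k) (B : Subgroup G) [B.Normal]
    (hB : (⁅B, B⁆ : Subgroup G) ≤ Subgroup.centralizer (B : Set G)) :
    derivedSeries G (k + 1) ≤ Subgroup.centralizer (B : Set G) := by
  let A : Subgroup G := B ⊓ Subgroup.centralizer (B : Set G)
  have hA : ∀ a ∈ A, ∀ b ∈ A, a * b = b * a := by
    rintro a ⟨_, ha⟩ b ⟨hb, _⟩
    exact (Subgroup.mem_centralizer_iff.1 ha b hb).symm
  have hk' : (Module.finrank F V).factorial ≤ k :=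
    (Nat.factorial_le (Nat.le_self_pow two_ne_zero _)).trans hk
  have h1 : ⁅derivedSeries G k, B⁆ ≤ A := by
    rw [Subgroup.commutator_le]
    intro m hm b hb
    refine ⟨?_, central_class_two ρ hinj hρ k hk B hB m hm b hb⟩
    rw [commutatorElement_def]
    exact B.mul_mem (Subgroup.Normal.conj_mem inferInstance b hb m) (B.inv_mem hb)
  have h2 : ⁅⁅derivedSeries G k, B⁆, derivedSeries G k⁆ = ⊥ := by
    rw [Subgroup.commutator_eq_bot_iff_le_centralizer]
    intro a ha
    rw [Subgroup.mem_centralizer_iff]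
    intro m hm
    have := central_abelian ρ hinj hρ k hk' A hA m hm a (h1 ha)
    exact mul_inv_eq_iff_eq_mul.1 this
  rw [derivedSeries_succ, ← Subgroup.commutator_eq_bot_iff_le_centralizer]
  exact Subgroup.commutator_commutator_eq_bot_of_rotate h2
    (by rw [Subgroup.commutator_comm B]; exact h2)

theorem irr_faithful [IsAlgClosed F] [Group.IsSolvable G] [FiniteDimensional F V]
    [Nontrivial V] (ρ : Representation F G V) (hinj : Function.Injective ρ) (hρ : Irr ρ)
    (k : ℕ) (hk : (Module.finrank F V ^ 2).factorial ≤ k) : derivedSeries G (k + 2) = ⊥ := by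
  obtain ⟨N, hN⟩ := Group.IsSolvable.solvable (G := G)
  have key : ∀ i, ∀ j, k + 1 ≤ j → N ≤ j + i →
      derivedSeries G (k + 1) ≤ Subgroup.centralizer (derivedSeries G j : Set G) := by
    intro i
    induction i with
    | zero =>
      intro j _ h2
      have : derivedSeries G j = ⊥ := le_bot_iff.1 (hN ▸ derivedSeries_antitone G h2)
      rw [this]
      rw [← Subgroup.commutator_eq_bot_iff_le_centralizer]
      simp
    | succ i ih =>
      intro j h1 h2
      have h3 := ih (j + 1) (by omega) (by omega)
      refine lemmaC ρ hinj hρ k hk _ ?_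
      rw [← derivedSeries_succ]
      rw [Subgroup.le_centralizer_iff] at h3
      exact h3.trans (Subgroup.centralizer_le (derivedSeries_antitone G h1))
  have := key N (k + 1) le_rfl (by omega)
  rw [← Subgroup.commutator_eq_bot_iff_le_centralizer] at this
  exact this

theorem irr_bound [IsAlgClosed F] [Group.IsSolvable G] [FiniteDimensional F V]
    [Nontrivial V] (ρ : Representation F G V) (hρ : Irr ρ)
    (k : ℕ) (hk : (Module.finrank F V ^ 2).factorial ≤ k) (g : G)
    (hg : g ∈ derivedSeries G (k + 2)) : ρ g = 1 := by
  let Q := G ⧸ MonoidHom.ker ρ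
  let ρ' : Representation F Q V := QuotientGroup.lift (MonoidHom.ker ρ) ρ (fun _ h => h)
  have hinj : Function.Injective ρ' := by
    rw [injective_iff_map_eq_one]
    intro q
    induction q using QuotientGroup.induction_on with
    | H x =>
      intro hx
      exact (QuotientGroup.eq_one_iff x).2 hx
  have hρ' : Irr ρ' := fun W hW => hρ W fun g w hw => hW (QuotientGroup.mk g) w hw
  have hQ : Group.IsSolvable Q := inferInstance
  have h := irr_faithful ρ' hinj hρ' k hk
  have h1 : (QuotientGroup.mk' (MonoidHom.ker ρ)) g ∈ derivedSeries Q (k + 2) :=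
    map_derivedSeries_le_derivedSeries _ _ (Subgroup.mem_map_of_mem _ hg)
  rw [h, Subgroup.mem_bot] at h1
  exact (QuotientGroup.eq_one_iff g).1 h1

/-- the Zassenhaus-type bound -/
def zb : ℕ → ℕ
  | 0 => 0
  | n + 1 => zb n + 1 + ((n + 1) ^ 2).factorial + 2

theorem zb_succ (n : ℕ) : zb (n + 1) = zb n + 1 + ((n + 1) ^ 2).factorial + 2 := rfl

theorem zassenhaus.{u, v, w} (F : Type u) (G : Type v) [Field F] [IsAlgClosed F] [Group G]
    [Group.IsSolvable G] (n : ℕ) : ∀ (V : Type w) [AddCommGroup V] [Module F V]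
      [FiniteDimensional F V] (ρ : Representation F G V), Module.finrank F V ≤ n →
      ∀ g ∈ derivedSeries G (zb n), ρ g = 1 := by
  induction n with
  | zero =>
    intro V _ _ _ ρ h g _
    have : Subsingleton V := Module.finrank_zero_iff.1 (Nat.le_zero.1 h)
    exact Subsingleton.elim _ _
  | succ n ih =>
    intro V _ _ _ ρ h g hg
    rcases subsingleton_or_nontrivial V with hV | hV
    · exact Subsingleton.elim _ _
    by_cases hρ : Irr ρ
    · refine irr_bound ρ hρ (zb n + 1 + ((n + 1) ^ 2).factorial) ?_ g (by rw [← zb_succ]; exact hg)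
      exact (Nat.factorial_le (Nat.pow_le_pow_left h 2)).trans (Nat.le_add_left _ _)
    · simp only [Irr, not_forall, not_or] at hρ
      obtain ⟨W, hW, hbot, htop⟩ := hρ
      have hle : ∀ g, W ≤ W.comap (ρ g) := fun g w hw => hW g w hw
      have hd1 : Module.finrank F W < Module.finrank F V := Submodule.finrank_lt htop
      have hd2 : Module.finrank F (V ⧸ W) < Module.finrank F V := by
        have := W.finrank_quotient_add_finrank
        have h0 : 0 < Module.finrank F W := by
          have := Submodule.nontrivial_iff_ne_bot.2 hbot
          exact Module.finrank_pos
        omega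
      have h1 := ih W (ρ.subrepresentation W hle) (by omega)
      have h2 := ih (V ⧸ W) (ρ.quotient W hle) (by omega)
      have h1' : ∀ x ∈ derivedSeries G (zb n), ∀ w ∈ W, ρ x w = w := by
        intro x hx w hw
        have := congrArg (fun f => ((f (⟨w, hw⟩ : W) : W) : V)) (h1 x hx)
        exact this
      have h2' : ∀ x ∈ derivedSeries G (zb n), ∀ v, ρ x v - v ∈ W := by
        intro x hx v
        have := congrArg (fun f => f (Submodule.Quotient.mk v : V ⧸ W)) (h2 x hx)
        exact (Submodule.Quotient.eq W).1 this
      have hle2 : derivedSeries G (zb (n + 1)) ≤ derivedSeries G (zb n + 1) :=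
        derivedSeries_antitone G (by rw [zb_succ]; omega)
      have hker : derivedSeries G (zb n + 1) ≤ MonoidHom.ker ρ := by
        rw [derivedSeries_succ, Subgroup.commutator_le]
        intro x hx y hy
        have hxy : ρ (x * y) = ρ (y * x) := by
          ext v
          rw [map_mul, map_mul, Module.End.mul_apply, Module.End.mul_apply]
          have e1 := h1' x hx _ (h2' y hy v)
          have e2 := h1' y hy _ (h2' x hx v)
          rw [map_sub] at e1 e2
          have e3 : ρ x (ρ y v) = ρ y v - v + ρ x v := by rw [← e1]; abel
          have e4 : ρ y (ρ x v) = ρ x v - v + ρ y v := by rw [← e2]; abel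
          rw [e3, e4]; abel
        rw [MonoidHom.mem_ker]
        have : ⁅x, y⁆ = (x * y) * (y * x)⁻¹ := by rw [commutatorElement_def]; group
        rw [this, map_mul, hxy, ← map_mul, mul_inv_cancel, map_one]
      exact hker (hle2 hg)

end ZL

/-- If `H ≤ SL(n,ℤ)` is finitely generated and non-solvable, then `φ_p(H)` is
non-solvable for all but finitely many primes `p`. -/
theorem not_solvable_mod_p_cofinitely (n : ℕ) (hn : 2 ≤ n)
    (H : Subgroup (SL n ℤ)) (hFG : H.FG) (hns : ¬ IsSolvable H) :
    {p : ℕ | p.Prime ∧ IsSolvable (H.map (redMod n p))}.Finite := by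
  have hne : derivedSeries H (ZL.zb n) ≠ ⊥ := fun h => hns ⟨⟨_, h⟩⟩
  obtain ⟨⟨h, hmem⟩, hx⟩ := Subgroup.ne_bot_iff_exists_ne_one.1 hne
  have h1 : h ≠ 1 := fun e => hx (Subtype.ext e)
  have h2 : ((h : SL n ℤ) : Matrix (Fin n) (Fin n) ℤ) ≠ 1 := by
    intro e
    apply h1
    apply Subtype.ext
    apply Subtype.ext
    exact e
  obtain ⟨i, j, hij⟩ : ∃ i j, ((h : SL n ℤ) : Matrix (Fin n) (Fin n) ℤ) i j
      - (1 : Matrix (Fin n) (Fin n) ℤ) i j ≠ 0 := by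
    by_contra! hc
    exact h2 (Matrix.ext fun i j => sub_eq_zero.1 (hc i j))
  set c : ℤ := ((h : SL n ℤ) : Matrix (Fin n) (Fin n) ℤ) i j
      - (1 : Matrix (Fin n) (Fin n) ℤ) i j with hcdef
  refine (Set.finite_le_nat c.natAbs).subset ?_
  rintro p ⟨hp, hsol⟩
  have := Fact.mk hp
  have hsol' : Group.IsSolvable (H.map (redMod n p)) := hsol
  let F := AlgebraicClosure (ZMod p)
  let σ : SL n (ZMod p) →* SL n F := Matrix.SpecialLinearGroup.map (algebraMap (ZMod p) F)
  let τ : SL n F →* ((Fin n → F) →ₗ[F] (Fin n → F)) :=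
    { toFun := fun g => Matrix.toLin' (g : Matrix (Fin n) (Fin n) F)
      map_one' := by simp; rfl
      map_mul' := fun x y => by simp [Matrix.toLin'_mul]; rfl }
  let ρ : Representation F (H.map (redMod n p)) (Fin n → F) :=
    (τ.comp σ).comp (H.map (redMod n p)).subtype
  let f : H →* H.map (redMod n p) := (redMod n p).subgroupMap H
  have hf : f h ∈ derivedSeries (H.map (redMod n p)) (ZL.zb n) :=
    map_derivedSeries_le_derivedSeries f _ (Subgroup.mem_map_of_mem _ hmem)
  have hρ := ZL.zassenhaus F (H.map (redMod n p)) n (Fin n → F) ρ (by simp) _ hf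
  have hm : ((σ (redMod n p h) : SL n F) : Matrix (Fin n) (Fin n) F) = 1 := by
    apply Matrix.toLin'.injective
    rw [Matrix.toLin'_one]
    exact hρ
  have hentry := congrFun (congrFun hm i) j
  have e1 : ((σ (redMod n p h) : SL n F) : Matrix (Fin n) (Fin n) F) i j
      = algebraMap (ZMod p) F ((((h : SL n ℤ) : Matrix (Fin n) (Fin n) ℤ) i j : ℤ) : ZMod p) := rfl
  have e2 : (1 : Matrix (Fin n) (Fin n) F) i j
      = algebraMap (ZMod p) F (((1 : Matrix (Fin n) (Fin n) ℤ) i j : ℤ) : ZMod p) := by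
    by_cases hh : i = j
    · subst hh; simp
    · simp [Matrix.one_apply_ne hh]
  rw [e1, e2] at hentry
  have e3 := (algebraMap (ZMod p) F).injective hentry
  have e4 : ((c : ℤ) : ZMod p) = 0 := by
    rw [hcdef, Int.cast_sub, e3, sub_self]
  exact Nat.le_of_dvd (Int.natAbs_pos.2 hij) (Int.natCast_dvd.1 ((ZMod.intCast_zmod_eq_zero_iff_dvd c p).1 e4))
end
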